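/- Solution of the moment problem for compact semi-algebraic sets: Let f₁,…,f_k ∈ ℝ[x₁,…,x_d] be such that the basic closed semi-algebraic set K(f) is compact, and let L be a linear functional on ℝ[x₁,…,x_d] with L(t) ≥ 0 for all t in the preordering T(f). Then L is a K(f)-moment functional: there exists a Radon measure μ on ℝ^d supported on K(f) such that L(p) = ∫_{K(f)} p dμ for all p ∈ ℝ[x₁,…,x_d]. -/

import Mathlib

open MeasureTheory

/-- A Radon measure: finite on compact sets and inner regular with respect to compact sets. -/
def IsRadon {X : Type*} [TopologicalSpace X] [MeasurableSpace X] (μ : Measure X) : Prop :=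
  IsFiniteMeasureOnCompacts μ ∧ μ.InnerRegular

/-- A sum of squares of polynomials. -/
def IsSOS {d : ℕ} (p : MvPolynomial (Fin d) ℝ) : Prop :=
  ∃ (n : ℕ) (q : Fin n → MvPolynomial (Fin d) ℝ), p = ∑ i, (q i) ^ 2

/-- Membership in the preordering `T(f)` generated by `f 0, …, f (k-1)`. -/
def InPreordering {d k : ℕ} (f : Fin k → MvPolynomial (Fin d) ℝ)
    (p : MvPolynomial (Fin d) ℝ) : Prop :=
  ∃ σ : (Fin k → Bool) → MvPolynomial (Fin d) ℝ,
    (∀ e, IsSOS (σ e)) ∧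
    p = ∑ e : Fin k → Bool, (∏ i, if e i then f i else 1) * σ e

/-- The basic closed semi-algebraic set `K(f)`. -/
def SemiAlgSet {d k : ℕ} (f : Fin k → MvPolynomial (Fin d) ℝ) : Set (Fin d → ℝ) :=
  {x | ∀ i, 0 ≤ MvPolynomial.eval x (f i)}


section part1
open Polynomial

/-- The intermediate value property for polynomials. -/
def PolyIVT (K : Type*) [Field K] [LinearOrder K] : Prop :=
  ∀ (p : K[X]) (a b : K), a < b → p.eval a < 0 → 0 < p.eval b →
    ∃ c, a < c ∧ c < b ∧ p.eval c = 0

section ivt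
variable {K : Type*} [Field K] [LinearOrder K] [IsStrictOrderedRing K]

lemma PolyIVT.of_mul_neg (h : PolyIVT K) {p : K[X]} {a b : K} (hab : a < b)
    (hs : p.eval a * p.eval b < 0) : ∃ c, a < c ∧ c < b ∧ p.eval c = 0 := by
  rcases mul_neg_iff.1 hs with ⟨h1, h2⟩ | ⟨h1, h2⟩
  · obtain ⟨c, h3, h4, h5⟩ := h (-p) a b hab (by simpa using h1) (by simpa using h2)
    exact ⟨c, h3, h4, by simpa using h5⟩
  · exact h p a b hab h1 h2

lemma PolyIVT.same_sign (h : PolyIVT K) {p : K[X]} {a b : K} (hab : a ≤ b)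
    (hs : ∀ c, a ≤ c → c ≤ b → p.eval c ≠ 0) : 0 < p.eval a * p.eval b := by
  rcases hab.eq_or_lt with rfl | hab'
  · exact mul_self_pos.2 (hs _ le_rfl le_rfl)
  · by_contra hn
    have h1 : p.eval a * p.eval b ≠ 0 := mul_ne_zero (hs _ le_rfl hab) (hs _ hab le_rfl)
    obtain ⟨c, h3, h4, h5⟩ := h.of_mul_neg hab' (lt_of_le_of_ne (not_lt.1 hn) h1)
    exact hs c h3.le h4.le h5

lemma PolyIVT.rolle_aux (h : PolyIVT K) {p : K[X]} (hp : p ≠ 0) {a b : K} (hab : a < b)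
    (ha : p.eval a = 0) (hb : p.eval b = 0) (hn : ∀ c, a < c → c < b → p.eval c ≠ 0) :
    ∃ c, a < c ∧ c < b ∧ p.derivative.eval c = 0 := by
  obtain ⟨q, hq, hqa⟩ := exists_eq_pow_rootMultiplicity_mul_and_not_dvd p hp a
  have hm : 0 < p.rootMultiplicity a := (rootMultiplicity_pos hp).2 ha
  obtain ⟨m, hm'⟩ := Nat.exists_eq_succ_of_ne_zero hm.ne'
  rw [hm'] at hq
  have hq0 : q ≠ 0 := by rintro rfl; simp at hqa
  have hqb : q.eval b = 0 := by
    have := hb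
    rw [hq] at this
    simp only [eval_mul, eval_pow, eval_sub, eval_X, eval_C] at this
    exact (mul_eq_zero.1 this).resolve_left (pow_ne_zero _ (sub_ne_zero.2 hab.ne'))
  obtain ⟨r, hr, hrb⟩ := exists_eq_pow_rootMultiplicity_mul_and_not_dvd q hq0 b
  have hk : 0 < q.rootMultiplicity b := (rootMultiplicity_pos hq0).2 hqb
  obtain ⟨k, hk'⟩ := Nat.exists_eq_succ_of_ne_zero hk.ne'
  rw [hk'] at hr
  have hra : r.eval a ≠ 0 := by
    intro h0
    apply hqa
    rw [dvd_iff_isRoot, IsRoot, hr]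
    simp [h0]
  have hrb' : r.eval b ≠ 0 := fun h0 => hrb (dvd_iff_isRoot.2 h0)
  have hpr : ∀ c, p.eval c = (c - a) ^ (m+1) * ((c - b) ^ (k+1) * r.eval c) := by
    intro c; rw [hq, hr]; simp
  have hrn : 0 < r.eval a * r.eval b := by
    apply h.same_sign hab.le
    intro c h1 h2 h3
    rcases h1.eq_or_lt with rfl | h1
    · exact hra h3
    rcases h2.eq_or_lt with rfl | h2
    · exact hrb' h3
    exact hn c h1 h2 (by rw [hpr, h3]; simp)
  set s : K[X] := (C ((m:K)+1) * (X - C b) + C ((k:K)+1) * (X - C a)) * r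
    + (X - C a) * (X - C b) * derivative r with hs
  have hd : derivative p = (X - C a)^m * (X - C b)^k * s := by
    rw [hq, hr, hs]
    simp only [derivative_mul, derivative_X_sub_C_pow, Nat.succ_eq_add_one, Nat.add_sub_cancel]
    simp only [Nat.cast_add, Nat.cast_one, C_add, C_1, map_natCast]
    ring
  obtain ⟨c, h1, h2, h3⟩ := h.of_mul_neg (p := s) hab (by
    have e1 : s.eval a = ((m:K)+1) * (a - b) * r.eval a := by simp [hs]
    have e2 : s.eval b = ((k:K)+1) * (b - a) * r.eval b := by simp [hs]
    rw [e1, e2]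
    have h1 : (0:K) < (m:K)+1 := by positivity
    have h2 : (0:K) < (k:K)+1 := by positivity
    have h3 : 0 < b - a := sub_pos.2 hab
    have : 0 < ((m:K)+1) * ((k:K)+1) * ((b-a) * (b-a)) * (r.eval a * r.eval b) := by positivity
    linarith [this, show ((m:K)+1) * (a - b) * r.eval a * (((k:K)+1) * (b - a) * r.eval b) =
      - (((m:K)+1) * ((k:K)+1) * ((b-a) * (b-a)) * (r.eval a * r.eval b)) by ring])
  exact ⟨c, h1, h2, by rw [hd]; simp [h3]⟩

lemma PolyIVT.rolle (h : PolyIVT K) {p : K[X]} {a b : K} (hab : a < b)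
    (ha : p.eval a = 0) (hb : p.eval b = 0) :
    ∃ c, a < c ∧ c < b ∧ p.derivative.eval c = 0 := by
  by_cases hp : p = 0
  · exact ⟨(a+b)/2, by linarith, by linarith, by simp [hp]⟩
  let s := p.roots.toFinset.filter (fun x => a < x)
  have hs : ∀ x, x ∈ s ↔ p.eval x = 0 ∧ a < x := by intro x; simp [s, hp]
  have hne : s.Nonempty := ⟨b, (hs b).2 ⟨hb, hab⟩⟩
  have hm := (hs _).1 (s.min'_mem hne)
  obtain ⟨c, h1, h2, h3⟩ := h.rolle_aux hp hm.2 ha hm.1 (by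
    intro c h1 h2 h3
    exact absurd (s.min'_le c ((hs c).2 ⟨h3, h1⟩)) (not_le.2 h2))
  exact ⟨c, h1, h2.trans_le (s.min'_le b ((hs b).2 ⟨hb, hab⟩)), h3⟩

lemma PolyIVT.gap (h : PolyIVT K) {p : K[X]} {u r v : K} (hur : u < r) (hrv : r < v)
    (hr : p.eval r = 0) (hd : ∀ c, u < c → c < v → p.derivative.eval c ≠ 0) :
    p.eval u * p.eval v < 0 := by
  obtain ⟨q, hq⟩ := dvd_iff_isRoot.2 (show p.IsRoot r from hr)
  have hqr : q.eval r ≠ 0 := by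
    intro h0
    apply hd r hur hrv
    rw [hq]; simp [h0]
  have : 0 < q.eval u * q.eval v := by
    apply h.same_sign (hur.trans hrv).le
    intro c h1 h2 h3
    have hc : p.eval c = 0 := by rw [hq]; simp [h3]
    rcases lt_trichotomy c r with h4 | rfl | h4
    · obtain ⟨d, h5, h6, h7⟩ := h.rolle h4 hc hr
      exact hd d (h1.trans_lt h5) (h6.trans hrv) h7
    · exact hqr h3
    · obtain ⟨d, h5, h6, h7⟩ := h.rolle h4 hr hc
      exact hd d (hur.trans h5) (h6.trans_le h2) h7
  rw [hq]
  simp only [eval_mul, eval_sub, eval_X, eval_C]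
  nlinarith [mul_pos (mul_pos (sub_pos.2 hur) (sub_pos.2 hrv)) this]

lemma root_bound {p : K[X]} (hp : p.Monic) {y : K} (hy : p.eval y = 0) :
    |y| < 1 + ∑ i ∈ Finset.range p.natDegree, (1 + p.coeff i ^ 2) := by
  set S := ∑ i ∈ Finset.range p.natDegree, (1 + p.coeff i ^ 2) with hS
  by_contra hn
  push Not at hn
  have hS0 : 0 ≤ S := Finset.sum_nonneg fun i _ => by positivity
  have hy1 : 1 ≤ |y| := by linarith
  have hd : p.natDegree ≠ 0 := by
    intro h0
    rw [(Monic.natDegree_eq_zero hp).1 h0] at hy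
    simp at hy
  obtain ⟨n, hn'⟩ := Nat.exists_eq_succ_of_ne_zero hd
  rw [Nat.succ_eq_add_one] at hn'
  have e : y ^ (n+1) = - ∑ i ∈ Finset.range (n+1), p.coeff i * y ^ i := by
    rw [eval_eq_sum_range, Finset.sum_range_succ, hp.coeff_natDegree, one_mul, hn'] at hy
    linear_combination hy
  have e2 : |y| ^ (n+1) ≤ S * |y| ^ n := by
    rw [← abs_pow, e, abs_neg, hS, hn', Finset.sum_mul]
    refine (Finset.abs_sum_le_sum_abs _ _).trans (Finset.sum_le_sum fun i hi => ?_)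
    rw [abs_mul, abs_pow]
    have h1 : |p.coeff i| ≤ 1 + p.coeff i ^ 2 := by
      rw [← sq_abs]; nlinarith [sq_nonneg (|p.coeff i| - 1), abs_nonneg (p.coeff i)]
    have h2 : |y| ^ i ≤ |y| ^ n := pow_le_pow_right₀ hy1 (by simp at hi; omega)
    gcongr
  have h3 : 0 < |y| ^ n := by positivity
  rw [pow_succ, mul_comm] at e2
  have := le_of_mul_le_mul_right e2 h3
  linarith

end ivt

end part1


section part2
open Polynomial

set_option linter.unusedSectionVars false
set_option linter.unusedSimpArgs false

lemma exists_nbrs {G N : Type*} [LinearOrder N] (f : G → N) (y : N) (Z : Finset G)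
    (hy : ∀ z ∈ Z, f z ≠ y) {u₀ v₀ : G} (hu : f u₀ < y) (hv : y < f v₀) :
    ∃ u v, f u < y ∧ y < f v ∧ ∀ z ∈ Z, f z ≤ f u ∨ f v ≤ f z := by
  classical
  induction Z using Finset.induction_on with
  | empty => exact ⟨u₀, v₀, hu, hv, by simp⟩
  | insert z Z hz ih =>
    obtain ⟨u, v, h1, h2, h3⟩ := ih (fun w hw => hy w (Finset.mem_insert_of_mem hw))
    rcases (hy z (Finset.mem_insert_self _ _)).lt_or_gt with h | h
    · rcases le_total (f z) (f u) with h4 | h4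
      · refine ⟨u, v, h1, h2, fun w hw => ?_⟩
        rcases Finset.mem_insert.1 hw with rfl | hw
        · exact Or.inl h4
        · exact h3 w hw
      · refine ⟨z, v, h, h2, fun w hw => ?_⟩
        rcases Finset.mem_insert.1 hw with rfl | hw
        · exact Or.inl le_rfl
        · exact (h3 w hw).imp_left (fun h5 => h5.trans h4)
    · rcases le_total (f v) (f z) with h4 | h4
      · refine ⟨u, v, h1, h2, fun w hw => ?_⟩
        rcases Finset.mem_insert.1 hw with rfl | hw
        · exact Or.inr h4
        · exact h3 w hw
      · refine ⟨u, z, h1, h, fun w hw => ?_⟩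
        rcases Finset.mem_insert.1 hw with rfl | hw
        · exact Or.inr le_rfl
        · exact (h3 w hw).imp_right (fun h5 => h4.trans h5)

section single
variable {G N : Type*} [CommRing G] [IsDomain G] [DecidableEq G] [Field N] [LinearOrder N] [IsStrictOrderedRing N]
  (f : G →+* N)

lemma f_ne_zero (hinv : ∀ c : G, c ≠ 0 → ∃ d, c * d = 1) {c : G} (hc : c ≠ 0) : f c ≠ 0 := by
  obtain ⟨d, hd⟩ := hinv c hc
  intro h
  have := congrArg f hd
  simp [h] at this

lemma f_inj (hinv : ∀ c : G, c ≠ 0 → ∃ d, c * d = 1) : Function.Injective f := by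
  rw [injective_iff_map_eq_zero]
  intro a ha
  by_contra h
  exact f_ne_zero f hinv h ha

lemma eval_map_f (g : G[X]) (c : G) : (g.map f).eval (f c) = f (g.eval c) := by
  rw [eval_map, eval₂_at_apply]

lemma exists_half (hinv : ∀ c : G, c ≠ 0 → ∃ d, c * d = 1) (u v : G) :
    ∃ c, f c = (f u + f v) / 2 := by
  have h2 : (2 : G) ≠ 0 := by
    intro h
    have := congrArg f h
    rw [map_ofNat, map_zero] at this
    exact two_ne_zero this
  obtain ⟨d, hd⟩ := hinv 2 h2
  refine ⟨(u + v) * d, ?_⟩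
  have : 2 * f d = 1 := by
    have := congrArg f hd
    rwa [map_mul, map_ofNat, map_one] at this
  rw [map_mul, map_add]
  linear_combination (f u + f v) / 2 * this

lemma exists_sep (hinv : ∀ c : G, c ≠ 0 → ∃ d, c * d = 1) (y : N) (Z : Finset G)
    (hy : ∀ z ∈ Z, f z ≠ y) :
    ∃ c, ∀ z ∈ Z, (f z < y → f z < f c) ∧ (y < f z → f c < f z) := by
  set B : G := 1 + ∑ z ∈ Z, (1 + z ^ 2) with hB
  have hb : ∀ z ∈ Z, |f z| < f B := by
    intro z hz
    have h1 : 1 + f z ^ 2 ≤ ∑ z ∈ Z, (1 + f z ^ 2) :=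
      Finset.single_le_sum (f := fun z => 1 + f z ^ 2) (fun i _ => by positivity) hz
    have h2 : f B = 1 + ∑ z ∈ Z, (1 + f z ^ 2) := by simp [hB]
    rw [h2]
    have h3 : |f z| ≤ 1 + f z ^ 2 := by
      rw [← sq_abs]; nlinarith [sq_nonneg (|f z| - 1), abs_nonneg (f z)]
    linarith
  by_cases h1 : y < f B
  · by_cases h2 : f (-B) < y
    · obtain ⟨u, v, h3, h4, h5⟩ := exists_nbrs f y Z hy h2 h1
      obtain ⟨c, hc⟩ := exists_half f hinv u v
      refine ⟨c, fun z hz => ⟨fun h => ?_, fun h => ?_⟩⟩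
      · rcases h5 z hz with h6 | h6 <;> linarith
      · rcases h5 z hz with h6 | h6 <;> linarith
    · refine ⟨-B, fun z hz => ⟨fun h => ?_, fun h => ?_⟩⟩
      · have := (abs_lt.1 (hb z hz)).1
        rw [map_neg] at *
        linarith
      · have := (abs_lt.1 (hb z hz)).1
        rw [map_neg] at *
        linarith
  · refine ⟨B, fun z hz => ⟨fun h => ?_, fun h => ?_⟩⟩
    · exact (abs_lt.1 (hb z hz)).2
    · have := (abs_lt.1 (hb z hz)).2
      linarith

lemma exists_monic_assoc (hinv : ∀ c : G, c ≠ 0 → ∃ d, c * d = 1) {g : G[X]} (hg : g ≠ 0) :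
    ∃ h : G[X], h.Monic ∧ h.natDegree = g.natDegree ∧ ∃ d : G, h = C d * g := by
  obtain ⟨d, hd⟩ := hinv g.leadingCoeff (leadingCoeff_ne_zero.2 hg)
  have hd0 : d ≠ 0 := by rintro rfl; simp at hd
  refine ⟨C d * g, ?_, ?_, d, rfl⟩
  · rw [Monic, leadingCoeff_mul, leadingCoeff_C, mul_comm, hd]
  · rw [natDegree_C_mul hd0]

lemma exists_bound (hinv : ∀ c : G, c ≠ 0 → ∃ d, c * d = 1) {g : G[X]} (hg : g ≠ 0) :
    ∃ B : G, ∀ y, (g.map f).eval y = 0 → f (-B) < y ∧ y < f B := by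
  obtain ⟨h, hm, -, d, hd⟩ := exists_monic_assoc hinv hg
  refine ⟨1 + ∑ i ∈ Finset.range h.natDegree, (1 + h.coeff i ^ 2), fun y hy => ?_⟩
  have h1 : (h.map f).eval y = 0 := by rw [hd]; simp [hy]
  have := root_bound (hm.map f) h1
  rw [hm.natDegree_map] at this
  simp only [coeff_map] at this
  rw [abs_lt] at this
  simpa using this

lemma sign_eq_of_mul_pos {a b : N} (h : 0 < a * b) : SignType.sign a = SignType.sign b := by
  rcases pos_and_pos_or_neg_and_neg_of_mul_pos h with ⟨h1, h2⟩ | ⟨h1, h2⟩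
  · rw [sign_pos h1, sign_pos h2]
  · rw [sign_neg h1, sign_neg h2]

lemma sign_sep (hN : PolyIVT N) {g : G[X]} (hg : g ≠ 0) {x : N} {c : G}
    (hx : ∀ z : G, f z ≠ x)
    (hr : ∀ r, (g.map f).eval r = 0 → ∃ z, g.eval z = 0 ∧ f z = r)
    (hc : ∀ z ∈ g.roots.toFinset, (f z < x → f z < f c) ∧ (x < f z → f c < f z)) :
    SignType.sign ((g.map f).eval x) = SignType.sign ((g.map f).eval (f c)) := by
  rcases le_total x (f c) with h | h
  · apply sign_eq_of_mul_pos
    apply hN.same_sign h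
    intro r h1 h2 h3
    obtain ⟨z, hz, rfl⟩ := hr r h3
    have := (hc z (by simp [hg, hz])).2 (lt_of_le_of_ne h1 (hx z).symm)
    exact absurd h2 (not_le.2 this)
  · symm
    apply sign_eq_of_mul_pos
    apply hN.same_sign h
    intro r h1 h2 h3
    obtain ⟨z, hz, rfl⟩ := hr r h3
    have := (hc z (by simp [hg, hz])).1 (lt_of_le_of_ne h2 (hx z))
    exact absurd h1 (not_le.2 this)

end single

section double
variable {G O M : Type*} [CommRing G] [IsDomain G] [DecidableEq G] [Field O] [LinearOrder O] [IsStrictOrderedRing O]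
  [Field M] [LinearOrder M] [IsStrictOrderedRing M]
  (f₁ : G →+* O) (f₂ : G →+* M)

/-- roots of low degree polynomials already lie in the base -/
def RootsIn (n : ℕ) : Prop := ∀ g : G[X], g ≠ 0 → g.natDegree < n →
    ∀ x : O, (g.map f₁).eval x = 0 → ∃ c, f₁ c = x

variable {f₁ f₂} (hs : ∀ c, SignType.sign (f₁ c) = SignType.sign (f₂ c))
include hs

lemma tr_neg {c : G} : f₁ c < 0 ↔ f₂ c < 0 := by
  rw [← sign_eq_neg_one_iff, ← sign_eq_neg_one_iff, hs]

lemma tr_zero {c : G} : f₁ c = 0 ↔ f₂ c = 0 := by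
  rw [← sign_eq_zero_iff, hs, sign_eq_zero_iff]

lemma tr_lt {a b : G} : f₁ a < f₁ b ↔ f₂ a < f₂ b := by
  have := tr_neg hs (c := a - b)
  rwa [map_sub, map_sub, sub_neg, sub_neg] at this

lemma tr_eval_zero {g : G[X]} {c : G} :
    (g.map f₁).eval (f₁ c) = 0 ↔ (g.map f₂).eval (f₂ c) = 0 := by
  rw [eval_map_f, eval_map_f, tr_zero hs]

lemma tr_eval_neg {g : G[X]} {u v : G} :
    (g.map f₁).eval (f₁ u) * (g.map f₁).eval (f₁ v) < 0 ↔
    (g.map f₂).eval (f₂ u) * (g.map f₂).eval (f₂ v) < 0 := by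
  rw [eval_map_f, eval_map_f, eval_map_f, eval_map_f, ← map_mul, ← map_mul, tr_neg hs]

variable (hinv : ∀ c : G, c ≠ 0 → ∃ d, c * d = 1) (h1 : PolyIVT O) (h2 : PolyIVT M)
include hinv h1 h2

omit hs h1 h2 [IsDomain G] [LinearOrder O] [IsStrictOrderedRing O] [Field M] [LinearOrder M] [IsStrictOrderedRing M] in
lemma eval_zero_iff (f : G →+* O) {g : G[X]} {c : G} :
    (g.map f).eval (f c) = 0 ↔ g.eval c = 0 := by
  rw [eval_map, eval₂_at_apply]
  constructor
  · intro h
    by_contra h'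
    obtain ⟨d, hd⟩ := hinv _ h'
    have := congrArg f hd
    simp [h] at this
  · intro h; simp [h]

omit hs h1 h2 [LinearOrder M] [IsStrictOrderedRing M] [LinearOrder O] [IsStrictOrderedRing O] [Field M] in
lemma der_ne [CharZero O] (f : G →+* O) {g : G[X]} (hg : g.natDegree ≠ 0) : derivative g ≠ 0 := by
  intro h
  have := (Polynomial.derivative_eq_zero (R := O) (p := g.map f)).1 (by
    rw [derivative_map, h]; simp)
  have hinj : Function.Injective f := by
    rw [injective_iff_map_eq_zero]
    intro a ha
    by_contra h
    obtain ⟨d, hd⟩ := hinv a h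
    have := congrArg f hd
    simp [ha] at this
  rw [natDegree_map_eq_of_injective hinj] at this
  exact hg this

lemma roots_transfer {n : ℕ} (H : RootsIn f₁ n) : ∀ (k : ℕ) (g : G[X]), g.natDegree = k →
    g ≠ 0 → g.natDegree < n →
    ∀ y : M, (g.map f₂).eval y = 0 → ∃ c, f₂ c = y := by
  intro k
  induction k using Nat.strong_induction_on with
  | _ k ih =>
  intro g hgk hg hgn y hy
  have hd0 : g.natDegree ≠ 0 := by
    intro h0
    obtain ⟨a, rfl⟩ := natDegree_eq_zero.1 h0
    have ha : a ≠ 0 := by rintro rfl; simp at hg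
    simp at hy
    exact f_ne_zero f₂ hinv ha hy
  have hg' : derivative g ≠ 0 := der_ne hinv f₁ hd0
  have hlt : (derivative g).natDegree < g.natDegree := natDegree_derivative_lt hd0
  by_contra hno
  push Not at hno
  obtain ⟨B, hB⟩ := exists_bound f₂ hinv hg
  obtain ⟨u, v, hu, hv, hZ⟩ := exists_nbrs f₂ y (derivative g).roots.toFinset
    (fun z _ => hno z) (hB y hy).1 (hB y hy).2
  have hM : ∀ c, f₂ u < c → c < f₂ v → (derivative (g.map f₂)).eval c ≠ 0 := by
    intro c hc1 hc2 hc3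
    rw [derivative_map] at hc3
    obtain ⟨z, rfl⟩ := ih _ (hgk ▸ hlt) (derivative g) rfl hg' (hlt.trans hgn) c hc3
    rcases hZ z (by simp [hg', (eval_zero_iff hinv f₂).1 hc3]) with h | h
    · exact absurd hc1 (not_lt.2 h)
    · exact absurd hc2 (not_lt.2 h)
  have hneg := (tr_eval_neg hs).2 (h2.gap hu hv hy hM)
  have huv := (tr_lt hs).2 (hu.trans hv)
  obtain ⟨x, hx1, hx2, hx3⟩ := h1.of_mul_neg huv hneg
  obtain ⟨c, rfl⟩ := H g hg hgn x hx3
  have hc := (tr_eval_zero hs).1 hx3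
  rw [tr_lt hs] at hx1 hx2
  rcases (hno c).lt_or_gt with h | h
  · obtain ⟨d, hd1, hd2, hd3⟩ := h2.rolle h hc hy
    exact hM d (hx1.trans hd1) (hd2.trans hv) hd3
  · obtain ⟨d, hd1, hd2, hd3⟩ := h2.rolle h hy hc
    exact hM d (hu.trans hd1) (hd2.trans hx2) hd3

lemma alg_step {n : ℕ} (H : RootsIn f₁ n) {p : G[X]} (hp : p.Monic) (hpn : p.natDegree = n)
    {x : O} (hx : (p.map f₁).eval x = 0) (hxG : ∀ c, f₁ c ≠ x) :
    ∃ y : M, ∀ g : G[X], SignType.sign ((g.map f₁).eval x) = SignType.sign ((g.map f₂).eval y) := by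
  have hd0 : p.natDegree ≠ 0 := by
    intro h0
    rw [hp.natDegree_eq_zero.1 h0] at hx
    simp at hx
  have hp0 : p ≠ 0 := hp.ne_zero
  have hp' : derivative p ≠ 0 := der_ne hinv f₁ hd0
  have hlt : (derivative p).natDegree < n := hpn ▸ natDegree_derivative_lt hd0
  obtain ⟨B, hB⟩ := exists_bound f₁ hinv hp0
  obtain ⟨u, v, hu, hv, hZ⟩ := exists_nbrs f₁ x (derivative p).roots.toFinset
    (fun z _ => hxG z) (hB x hx).1 (hB x hx).2
  have hO : ∀ c, f₁ u < c → c < f₁ v → (derivative (p.map f₁)).eval c ≠ 0 := by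
    intro c hc1 hc2 hc3
    rw [derivative_map] at hc3
    obtain ⟨z, rfl⟩ := H _ hp' hlt c hc3
    rcases hZ z (by simp [hp', (eval_zero_iff hinv f₁).1 hc3]) with h | h
    · exact absurd hc1 (not_lt.2 h)
    · exact absurd hc2 (not_lt.2 h)
  have hM : ∀ c, f₂ u < c → c < f₂ v → (derivative (p.map f₂)).eval c ≠ 0 := by
    intro c hc1 hc2 hc3
    rw [derivative_map] at hc3
    obtain ⟨z, rfl⟩ := roots_transfer hs hinv h1 h2 H _ _ rfl hp' hlt c hc3
    rw [← tr_lt hs] at hc1 hc2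
    rcases hZ z (by simp [hp', (eval_zero_iff hinv f₂).1 hc3]) with h | h
    · exact absurd hc1 (not_lt.2 h)
    · exact absurd hc2 (not_lt.2 h)
  have hneg := h1.gap hu hv hx hO
  have huv := (tr_lt hs).1 (hu.trans hv)
  obtain ⟨y, hy1, hy2, hy3⟩ := h2.of_mul_neg huv ((tr_eval_neg hs).1 hneg)
  have hyG : ∀ c, f₂ c ≠ y := by
    rintro c rfl
    rw [← tr_lt hs] at hy1 hy2
    rw [← tr_eval_zero hs] at hy3
    rcases (hxG c).lt_or_gt with h | h
    · obtain ⟨d, hd1, hd2, hd3⟩ := h1.rolle h hy3 hx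
      exact hO d (hy1.trans hd1) (hd2.trans hv) hd3
    · obtain ⟨d, hd1, hd2, hd3⟩ := h1.rolle h hx hy3
      exact hO d (hu.trans hd1) (hd2.trans hy2) hd3
  have key : ∀ a b c : O, a * b < 0 → a * c < 0 → c * b < 0 → False := by
    intro a b c h1 h2 h3
    have := mul_pos_of_neg_of_neg h1 h2
    nlinarith [mul_neg_of_pos_of_neg this h3, sq_nonneg (a * b * c)]
  have cut1 : ∀ c, f₁ c < x → f₂ c < y := by
    intro c hc
    by_contra hn
    have hyc : y < f₂ c := lt_of_le_of_ne (not_lt.1 hn) (hyG c).symm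
    have huc : f₁ u < f₁ c := (tr_lt hs).2 (hy1.trans hyc)
    by_cases hcv : f₂ c < f₂ v
    · have e1 := h1.gap hc hv hx (fun d hd1 hd2 => hO d (huc.trans hd1) hd2)
      have e2 := (tr_eval_neg hs).2
        (h2.gap hy1 hyc hy3 (fun d hd1 hd2 => hM d hd1 (hd2.trans hcv)))
      exact key _ _ _ hneg e2 e1
    · rw [← tr_lt hs] at hcv
      exact hcv (hc.trans hv)
  have cut2 : ∀ c, x < f₁ c → y < f₂ c := by
    intro c hc
    by_contra hn
    have hyc : f₂ c < y := lt_of_le_of_ne (not_lt.1 hn) (hyG c)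
    have hcv : f₁ c < f₁ v := (tr_lt hs).2 (hyc.trans hy2)
    by_cases huc : f₂ u < f₂ c
    · have e1 := h1.gap hu hc hx (fun d hd1 hd2 => hO d hd1 (hd2.trans hcv))
      have e2 := (tr_eval_neg hs).2
        (h2.gap hyc hy2 hy3 (fun d hd1 hd2 => hM d (huc.trans hd1) hd2))
      exact key _ _ _ hneg e1 e2
    · rw [← tr_lt hs] at huc
      exact huc (hu.trans hc)
  refine ⟨y, fun g => ?_⟩
  have main : ∀ g : G[X], g ≠ 0 → g.natDegree < n →
      SignType.sign ((g.map f₁).eval x) = SignType.sign ((g.map f₂).eval y) := by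
    intro g hg hgn
    obtain ⟨c, hc⟩ := exists_sep f₁ hinv x g.roots.toFinset (fun z _ => hxG z)
    have e1 := sign_sep f₁ h1 hg hxG (fun r hr => by
      obtain ⟨z, rfl⟩ := H g hg hgn r hr
      exact ⟨z, (eval_zero_iff hinv f₁).1 hr, rfl⟩) hc
    have e2 := sign_sep f₂ h2 hg (c := c) hyG (fun r hr => by
      obtain ⟨z, rfl⟩ := roots_transfer hs hinv h1 h2 H _ g rfl hg hgn r hr
      exact ⟨z, (eval_zero_iff hinv f₂).1 hr, rfl⟩) (by
      intro z hz
      constructor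
      · intro h
        rw [← tr_lt hs]
        apply (hc z hz).1
        by_contra hn
        exact absurd (cut2 z (lt_of_le_of_ne (not_lt.1 hn) (hxG z).symm)) (not_lt.2 h.le)
      · intro h
        rw [← tr_lt hs]
        apply (hc z hz).2
        by_contra hn
        exact absurd (cut1 z (lt_of_le_of_ne (not_lt.1 hn) (hxG z))) (not_lt.2 h.le))
    rw [e1, e2, eval_map_f, eval_map_f, hs]
  have ev1 : (g.map f₁).eval x = ((g %ₘ p).map f₁).eval x := by
    conv_lhs => rw [← modByMonic_add_div g p]
    simp [hx]
  have ev2 : (g.map f₂).eval y = ((g %ₘ p).map f₂).eval y := by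
    conv_lhs => rw [← modByMonic_add_div g p]
    simp [hy3]
  rw [ev1, ev2]
  by_cases h0 : g %ₘ p = 0
  · simp [h0]
  · apply main _ h0
    rw [← hpn]
    exact natDegree_modByMonic_lt _ hp (by rintro rfl; simp at hd0)

lemma transc_step (H : ∀ n, RootsIn f₁ n) (x : O) (S : Finset G[X]) :
    ∃ c : G, ∀ g ∈ S, SignType.sign ((g.map f₁).eval x) = SignType.sign ((g.map f₁).eval (f₁ c)) := by
  by_cases hx : ∃ c, f₁ c = x
  · obtain ⟨c, rfl⟩ := hx
    exact ⟨c, fun _ _ => rfl⟩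
  push Not at hx
  obtain ⟨c, hc⟩ := exists_sep f₁ hinv x (S.biUnion fun g => g.roots.toFinset) (fun z _ => hx z)
  refine ⟨c, fun g hg => ?_⟩
  by_cases h0 : g = 0
  · simp [h0]
  apply sign_sep f₁ h1 h0 hx
  · intro r hr
    obtain ⟨z, rfl⟩ := H _ g h0 (Nat.lt_succ_self _) r hr
    exact ⟨z, (eval_zero_iff hinv f₁).1 hr, rfl⟩
  · intro z hz
    exact hc z (Finset.mem_biUnion.2 ⟨g, hg, hz⟩)

end double

end part2


section part3
open Polynomial

section ext
variable {O M : Type*} [Field O] [LinearOrder O] [IsStrictOrderedRing O]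
  [Field M] [LinearOrder M] [IsStrictOrderedRing M]

/-- The pairs in the subring have the same sign. -/
def SignGood (Γ : Subring (O × M)) : Prop :=
  ∀ z ∈ Γ, SignType.sign z.1 = SignType.sign z.2

/-- first projection -/
def pr₁ (Γ : Subring (O × M)) : Γ →+* O := (RingHom.fst O M).comp Γ.subtype
/-- second projection -/
def pr₂ (Γ : Subring (O × M)) : Γ →+* M := (RingHom.snd O M).comp Γ.subtype

lemma exists_max_good (Γ₀ : Subring (O × M)) (h₀ : SignGood Γ₀) :
    ∃ Γ, Γ₀ ≤ Γ ∧ Maximal (fun Γ => SignGood Γ) Γ := by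
  apply zorn_le_nonempty₀ {Γ : Subring (O × M) | SignGood Γ} _ Γ₀ h₀
  intro c hc hch y hy
  refine ⟨sSup c, ?_, fun z hz => le_sSup hz⟩
  intro z hz
  rw [Subring.mem_sSup_of_directedOn ⟨y, hy⟩ hch.directedOn] at hz
  obtain ⟨s, hs, hzs⟩ := hz
  exact hc hs z hzs

lemma SignGood.zero_iff {Γ : Subring (O × M)} (h : SignGood Γ) {z : O × M} (hz : z ∈ Γ) :
    z.1 = 0 ↔ z.2 = 0 := by
  rw [← sign_eq_zero_iff, h z hz, sign_eq_zero_iff]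

lemma SignGood.inv_mem {Γ : Subring (O × M)} (hm : Maximal (fun Γ => SignGood Γ) Γ)
    (z : O × M) (hz : z ∈ Γ) (hz0 : z ≠ 0) : (z.1⁻¹, z.2⁻¹) ∈ Γ := by
  have hg : SignGood Γ := hm.1
  have ha : z.1 ≠ 0 := fun h => hz0 (Prod.ext h ((hg.zero_iff hz).1 h))
  have hb : z.2 ≠ 0 := fun h => hz0 (Prod.ext ((hg.zero_iff hz).2 h) h)
  let Γ' : Subring (O × M) :=
    { carrier := {w | ∃ n : ℕ, w * (z * z) ^ n ∈ Γ}
      mul_mem' := by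
        rintro a b ⟨n, hn⟩ ⟨m, hm⟩
        refine ⟨n + m, ?_⟩
        have := Γ.mul_mem hn hm
        convert this using 1
        ring
      one_mem' := ⟨0, by simp⟩
      add_mem' := by
        rintro a b ⟨n, hn⟩ ⟨m, hm⟩
        refine ⟨n + m, ?_⟩
        have h1 := Γ.mul_mem hn (Γ.pow_mem (Γ.mul_mem hz hz) m)
        have h2 := Γ.mul_mem hm (Γ.pow_mem (Γ.mul_mem hz hz) n)
        have := Γ.add_mem h1 h2
        convert this using 1
        ring
      zero_mem' := ⟨0, by simp⟩
      neg_mem' := by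
        rintro a ⟨n, hn⟩
        refine ⟨n, ?_⟩
        have := Γ.neg_mem hn
        convert this using 1
        ring }
  have hle : Γ ≤ Γ' := fun w hw => ⟨0, by simpa using hw⟩
  have hgood : SignGood Γ' := by
    rintro w ⟨n, hn⟩
    have := hg _ hn
    simp only [Prod.fst_mul, Prod.snd_mul, Prod.pow_fst, Prod.pow_snd, sign_mul] at this
    rwa [sign_pos (pow_pos (mul_self_pos.2 ha) n),
      sign_pos (pow_pos (mul_self_pos.2 hb) n), mul_one, mul_one] at this
  apply hm.2 hgood hle
  refine ⟨1, ?_⟩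
  convert hz using 1
  ext
  · simp [ha]
  · simp [hb]

lemma exists_ext (h1 : PolyIVT O) (h2 : PolyIVT M) (Γ₀ : Subring (O × M)) (h₀ : SignGood Γ₀)
    (x : O) : ∃ Γ, Γ₀ ≤ Γ ∧ SignGood Γ ∧ ∀ S : Finset (Γ)[X], ∃ c : Γ, ∀ g ∈ S,
      SignType.sign ((g.map (pr₁ Γ)).eval x) = SignType.sign ((g.map (pr₂ Γ)).eval (pr₂ Γ c)) := by
  classical
  obtain ⟨Γ, hle, hm⟩ := exists_max_good Γ₀ h₀
  have hg : SignGood Γ := hm.1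
  refine ⟨Γ, hle, hg, ?_⟩
  have hinv : ∀ c : Γ, c ≠ 0 → ∃ d, c * d = 1 := by
    intro c hc
    have hc0 : (c : O × M) ≠ 0 := by simpa using hc
    have ha : (c : O × M).1 ≠ 0 := fun h => hc0 (Prod.ext h ((hg.zero_iff c.2).1 h))
    have hb : (c : O × M).2 ≠ 0 := fun h => hc0 (Prod.ext ((hg.zero_iff c.2).2 h) h)
    refine ⟨⟨_, SignGood.inv_mem hm c c.2 hc0⟩, ?_⟩
    ext
    · simp [ha]
    · simp [hb]
  have hinj : Function.Injective (pr₁ Γ) := by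
    rw [injective_iff_map_eq_zero]
    intro a ha
    have ha' : (a : O × M).1 = 0 := ha
    ext
    · exact ha'
    · exact (hg.zero_iff a.2).1 ha'
  haveI : IsDomain Γ := hinj.isDomain (pr₁ Γ)
  have hs : ∀ c, SignType.sign (pr₁ Γ c) = SignType.sign (pr₂ Γ c) := fun c => hg c c.2
  have H : ∀ n, RootsIn (pr₁ Γ) n := by
    by_contra hno
    push Not at hno
    obtain ⟨n, hn, hmin⟩ : ∃ n, ¬ RootsIn (pr₁ Γ) n ∧ ∀ m < n, RootsIn (pr₁ Γ) m :=
      ⟨Nat.find hno, Nat.find_spec hno, fun m hm => by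
        have := Nat.find_min hno hm
        simpa using this⟩
    unfold RootsIn at hn
    push Not at hn
    obtain ⟨g, hg0, hgn, x, hx, hxG⟩ := hn
    obtain ⟨p, hp, hpn, d, hd⟩ := exists_monic_assoc hinv hg0
    obtain ⟨y, hy⟩ := alg_step hs hinv h1 h2 (hmin _ hgn) hp hpn (x := x)
      (by rw [hd]; simp [hx]) hxG
    let ψ : (Γ)[X] →+* O × M := (eval₂RingHom (pr₁ Γ) x).prod (eval₂RingHom (pr₂ Γ) y)
    have hle : Γ ≤ ψ.range := by
      intro c hc
      refine ⟨C ⟨c, hc⟩, ?_⟩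
      ext
      · simp [ψ, pr₁]
      · simp [ψ, pr₂]
    have hgood : SignGood ψ.range := by
      rintro _ ⟨g, rfl⟩
      have := hy g
      simpa [ψ, eval_map] using this
    have hmem : ψ X ∈ Γ := hm.2 hgood hle ⟨X, rfl⟩
    apply hxG ⟨ψ X, hmem⟩
    simp [pr₁, ψ]
  intro S
  obtain ⟨c, hc⟩ := transc_step hs hinv h1 h2 H x S
  refine ⟨c, fun g hg => ?_⟩
  rw [hc g hg, eval_map_f, eval_map_f, hs]

end ext

end part3


section part4
open Polynomial Filter

section germ
variable {I : Type*} (U : Ultrafilter I)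

lemma germ_ivt : PolyIVT (Germ (U : Filter I) ℝ) := by
  intro p a b hab ha hb
  have hrep : ∀ z : Germ (U : Filter I) ℝ, ∃ h : I → ℝ, (h : Germ (U : Filter I) ℝ) = z :=
    fun z => Germ.inductionOn z fun h => ⟨h, rfl⟩
  choose c hc using fun k => hrep (p.coeff k)
  obtain ⟨a, rfl⟩ := hrep a
  obtain ⟨b, rfl⟩ := hrep b
  let P : I → ℝ[X] := fun i => ∑ k ∈ Finset.range (p.natDegree + 1), C (c k i) * X ^ k
  have key : ∀ h : I → ℝ, p.eval (h : Germ (U : Filter I) ℝ) =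
      ((fun i => (P i).eval (h i) : I → ℝ) : Germ (U : Filter I) ℝ) := by
    intro h
    have e : (fun i => (P i).eval (h i)) =
        ∑ k ∈ Finset.range (p.natDegree + 1), c k * h ^ k := by
      ext i
      simp [P, eval_finsetSum]
    rw [e, eval_eq_sum_range]
    change _ = Germ.coeRingHom (U : Filter I) _
    rw [map_sum]
    refine Finset.sum_congr rfl fun k _ => ?_
    rw [map_mul, map_pow, ← hc]
    rfl
  rw [key] at ha hb
  have hab' := Germ.coe_lt.1 hab
  have ha' : ∀ᶠ i in (U : Filter I), (P i).eval (a i) < 0 := Germ.coe_lt.1 ha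
  have hb' : ∀ᶠ i in (U : Filter I), 0 < (P i).eval (b i) := Germ.coe_lt.1 hb
  have hev : ∀ᶠ i in (U : Filter I), ∃ r : ℝ, a i < r ∧ r < b i ∧ (P i).eval r = 0 := by
    filter_upwards [hab', ha', hb'] with i h1 h2 h3
    obtain ⟨r, hr, hr0⟩ := intermediate_value_Ioo h1.le
      ((P i).continuous.continuousOn) (show (0:ℝ) ∈ Set.Ioo _ _ from ⟨h2, h3⟩)
    exact ⟨r, hr.1, hr.2, hr0⟩
  obtain ⟨r, hr⟩ := hev.choice
  refine ⟨(r : Germ (U : Filter I) ℝ), Germ.coe_lt.2 (hr.mono fun i h => h.1),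
    Germ.coe_lt.2 (hr.mono fun i h => h.2.1), ?_⟩
  rw [key]
  exact Germ.coe_eq.2 (hr.mono fun i h => h.2.2)

lemma germ_sign (h : I → ℝ) (s : SignType) :
    SignType.sign (h : Germ (U : Filter I) ℝ) = s ↔
      ∀ᶠ i in (U : Filter I), SignType.sign (h i) = s := by
  have e0 : (0 : Germ (U : Filter I) ℝ) = ((fun _ => 0 : I → ℝ) : Germ (U : Filter I) ℝ) := rfl
  cases s
  · change SignType.sign (h : Germ (U : Filter I) ℝ) = 0 ↔ ∀ᶠ i in (U : Filter I), SignType.sign (h i) = 0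
    simp only [sign_eq_zero_iff]
    rw [e0, Germ.coe_eq]; rfl
  · change SignType.sign (h : Germ (U : Filter I) ℝ) = -1 ↔ ∀ᶠ i in (U : Filter I), SignType.sign (h i) = -1
    simp only [sign_eq_neg_one_iff]
    rw [e0, Germ.coe_lt]
  · change SignType.sign (h : Germ (U : Filter I) ℝ) = 1 ↔ ∀ᶠ i in (U : Filter I), SignType.sign (h i) = 1
    simp only [sign_eq_one_iff]
    rw [e0, Germ.coe_lt]

end germ

section realize
variable {O : Type*} [Field O] [LinearOrder O] [IsStrictOrderedRing O]

lemma sign_real_hom (ψ : ℝ →+* O) (r : ℝ) : SignType.sign (ψ r) = SignType.sign r := by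
  have pos : ∀ r : ℝ, 0 < r → 0 < ψ r := by
    intro r hr
    rw [← Real.mul_self_sqrt hr.le, map_mul]
    apply mul_self_pos.2
    rw [_root_.map_ne_zero]
    exact (Real.sqrt_pos.2 hr).ne'
  rcases lt_trichotomy r 0 with h | rfl | h
  · have := pos (-r) (by linarith)
    rw [map_neg] at this
    rw [sign_neg h, sign_neg (by linarith)]
  · simp
  · rw [sign_pos h, sign_pos (pos r h)]

theorem sign_realize (hO : PolyIVT O) (ψ : ℝ →+* O) : ∀ (d : ℕ) (x : Fin d → O)
    (S : Finset (MvPolynomial (Fin d) ℝ)), ∃ a : Fin d → ℝ, ∀ g ∈ S,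
      SignType.sign (MvPolynomial.eval a g) = SignType.sign (MvPolynomial.eval₂Hom ψ x g) := by
  classical
  intro d
  induction d with
  | zero =>
    intro x S
    refine ⟨Fin.elim0, fun g _ => ?_⟩
    rw [MvPolynomial.eq_C_of_isEmpty g]
    simp [sign_real_hom]
  | succ d ih =>
    intro x S
    obtain ⟨x₀, xt, rfl⟩ : ∃ x₀ xt, x = Fin.cons x₀ xt := ⟨x 0, Fin.tail x, by simp⟩
    choose a ha using ih xt
    let U : Ultrafilter (Finset (MvPolynomial (Fin d) ℝ)) := Ultrafilter.of atTop
    have hU : (U : Filter (Finset (MvPolynomial (Fin d) ℝ))) ≤ atTop := Ultrafilter.of_le _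
    let M := Germ (U : Filter (Finset (MvPolynomial (Fin d) ℝ))) ℝ
    let ρ : MvPolynomial (Fin d) ℝ →+* M :=
      (Germ.coeRingHom (U : Filter (Finset (MvPolynomial (Fin d) ℝ)))).comp
        (RingHom.pi (fun S => MvPolynomial.eval (a S)))
    have hρ : ∀ g, SignType.sign (MvPolynomial.eval₂Hom ψ xt g) = SignType.sign (ρ g) := by
      intro g
      symm
      apply (germ_sign U _ _).2
      apply hU
      filter_upwards [eventually_ge_atTop {g}] with T hT
      exact ha T g (Finset.singleton_subset_iff.1 hT)
    let θ₀ : MvPolynomial (Fin d) ℝ →+* O × M := (MvPolynomial.eval₂Hom ψ xt).prod ρ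
    obtain ⟨Γ, hle, -, hΓ⟩ := exists_ext hO (germ_ivt U) θ₀.range (by
      rintro _ ⟨g, rfl⟩
      exact hρ g) x₀
    let θ : MvPolynomial (Fin d) ℝ →+* Γ := θ₀.codRestrict Γ (fun g => hle ⟨g, rfl⟩)
    obtain ⟨c, hc⟩ := hΓ (S.image fun g => (MvPolynomial.finSuccEquiv ℝ d g).map θ)
    obtain ⟨h, hh⟩ : ∃ h : Finset (MvPolynomial (Fin d) ℝ) → ℝ, (h : M) = pr₂ Γ c :=
      Germ.inductionOn (pr₂ Γ c) fun h => ⟨h, rfl⟩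
    have e1 : ∀ g, eval₂ (MvPolynomial.eval₂Hom ψ xt) x₀ (MvPolynomial.finSuccEquiv ℝ d g) =
        MvPolynomial.eval₂Hom ψ (Fin.cons x₀ xt) g := by
      intro g
      have : ((eval₂RingHom (MvPolynomial.eval₂Hom ψ xt) x₀).comp
          (MvPolynomial.finSuccEquiv ℝ d : _ →+* _)) =
          MvPolynomial.eval₂Hom ψ (Fin.cons x₀ xt : Fin (d+1) → O) := by
        apply MvPolynomial.ringHom_ext
        · intro r
          simp [MvPolynomial.finSuccEquiv_comp_C_eq_C, MvPolynomial.finSuccEquiv_apply]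
        · intro i
          refine Fin.cases ?_ (fun j => ?_) i
          · simp [MvPolynomial.finSuccEquiv_X_zero]
          · simp [MvPolynomial.finSuccEquiv_X_succ]
      exact RingHom.congr_fun this g
    have e2 : ∀ g, eval₂ ρ (h : M) (MvPolynomial.finSuccEquiv ℝ d g) =
        ((fun S => MvPolynomial.eval (Fin.cons (h S) (a S) : Fin (d+1) → ℝ) g :
          Finset (MvPolynomial (Fin d) ℝ) → ℝ) : M) := by
      intro g
      have : ((eval₂RingHom ρ (h : M)).comp
          (MvPolynomial.finSuccEquiv ℝ d : _ →+* _)) =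
          (Germ.coeRingHom (U : Filter (Finset (MvPolynomial (Fin d) ℝ)))).comp
        (RingHom.pi (fun S => MvPolynomial.eval (Fin.cons (h S) (a S) : Fin (d+1) → ℝ))) := by
        apply MvPolynomial.ringHom_ext
        · intro r
          simp only [RingHom.comp_apply, RingHom.coe_coe, MvPolynomial.finSuccEquiv_apply,
            MvPolynomial.eval₂Hom_C, coe_eval₂RingHom, eval₂_C, ρ]
          refine congrArg _ (funext fun S => ?_)
          simp [RingHom.pi_apply]
        · intro i
          refine Fin.cases ?_ (fun j => ?_) i
          · simp only [RingHom.comp_apply, RingHom.coe_coe, MvPolynomial.finSuccEquiv_X_zero,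
              coe_eval₂RingHom, eval₂_X]
            change Germ.coeRingHom (U : Filter (Finset (MvPolynomial (Fin d) ℝ))) h = _
            refine congrArg _ (funext fun S => ?_)
            simp [RingHom.pi_apply]
          · simp only [RingHom.comp_apply, RingHom.coe_coe, MvPolynomial.finSuccEquiv_X_succ,
              coe_eval₂RingHom, eval₂_C, ρ]
            refine congrArg _ (funext fun S => ?_)
            simp [RingHom.pi_apply]
      exact RingHom.congr_fun this g
    have hall : ∀ g ∈ S, ∀ᶠ T in (U : Filter (Finset (MvPolynomial (Fin d) ℝ))),
        SignType.sign (MvPolynomial.eval (Fin.cons (h T) (a T) : Fin (d+1) → ℝ) g) =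
        SignType.sign (MvPolynomial.eval₂Hom ψ (Fin.cons x₀ xt) g) := by
      intro g hg
      rw [← germ_sign]
      have := hc _ (Finset.mem_image_of_mem _ hg)
      rw [Polynomial.map_map, Polynomial.map_map, eval_map, eval_map, ← hh] at this
      have f1 : (pr₁ Γ).comp θ = MvPolynomial.eval₂Hom ψ xt := by ext <;> rfl
      have f2 : (pr₂ Γ).comp θ = ρ := by
        apply RingHom.ext; intro g; rfl
      rw [f1, f2, e1, e2] at this
      exact this.symm
    have := (Filter.eventually_all_finset S).2 hall
    obtain ⟨T, hT⟩ := this.exists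
    exact ⟨_, hT⟩

end realize

end part4


section part5
open Polynomial

structure PCone {C : Type*} [Field C] (S : Set C) : Prop where
  add : ∀ x ∈ S, ∀ y ∈ S, x + y ∈ S
  mul : ∀ x ∈ S, ∀ y ∈ S, x * y ∈ S
  sq : ∀ x ∈ S, ∀ y ∈ S, (x - y) ^ 2 ∈ S
  supp : ∀ x ∈ S, -x ∈ S → x = 0

section ivt
variable {R : Type*} [Field R] [LinearOrder R] [IsStrictOrderedRing R]

/-- cone of weighted sums of squares -/
noncomputable def Qn (n : ℕ) : AddSubmonoid R[X] :=
  AddSubmonoid.closure {w | ∃ s : R, 0 ≤ s ∧ ∃ h : R[X], h.natDegree < n ∧ w = C s * h ^ 2}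

noncomputable def Qall (R : Type*) [Field R] [LinearOrder R] [IsStrictOrderedRing R] : AddSubmonoid R[X] :=
  AddSubmonoid.closure {w | ∃ s : R, 0 ≤ s ∧ ∃ h : R[X], w = C s * h ^ 2}

lemma Qn_nonneg {n : ℕ} {w : R[X]} (hw : w ∈ Qn n) (x : R) : 0 ≤ w.eval x := by
  induction hw using AddSubmonoid.closure_induction with
  | mem w hw =>
    obtain ⟨s, hs, h, -, rfl⟩ := hw
    simp only [eval_mul, eval_C, eval_pow]
    positivity
  | zero => simp
  | add u v _ _ hu hv => rw [eval_add]; exact add_nonneg hu hv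

lemma Qn_deg {n : ℕ} {w : R[X]} (hw : w ∈ Qn n) : w.natDegree ≤ 2 * (n - 1) := by
  induction hw using AddSubmonoid.closure_induction with
  | mem w hw =>
    obtain ⟨s, hs, h, hh, rfl⟩ := hw
    refine (natDegree_C_mul_le _ _).trans ?_
    rw [natDegree_pow]
    omega
  | zero => simp
  | add u v _ _ hu hv => exact (natDegree_add_le _ _).trans (max_le hu hv)

lemma Qn_root {n : ℕ} {w : R[X]} (hw : w ∈ Qn n) (c : R) :
    w.eval c = 0 → ∃ w' ∈ Qn n, w = (X - C c) ^ 2 * w' := by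
  induction hw using AddSubmonoid.closure_induction with
  | mem w hw =>
    obtain ⟨s, hs, h, hh, rfl⟩ := hw
    intro h0
    simp only [eval_mul, eval_C, eval_pow, mul_eq_zero, pow_eq_zero_iff two_ne_zero] at h0
    rcases h0 with rfl | h0
    · exact ⟨0, zero_mem _, by simp⟩
    · obtain ⟨g, rfl⟩ := dvd_iff_isRoot.2 h0
      refine ⟨C s * g ^ 2, AddSubmonoid.subset_closure ⟨s, hs, g, ?_, rfl⟩, by ring⟩
      by_cases hg : g = 0
      · subst hg; simpa using hh
      · rw [natDegree_mul (X_sub_C_ne_zero c) hg, natDegree_X_sub_C] at hh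
        omega
  | zero => intro _; exact ⟨0, zero_mem _, by simp⟩
  | add u v hu' hv' hu hv =>
    intro h0
    have h1 := Qn_nonneg hu' c
    have h2 := Qn_nonneg hv' c
    rw [eval_add] at h0
    obtain ⟨u', hu1, hu2⟩ := hu (by linarith)
    obtain ⟨v', hv1, hv2⟩ := hv (by linarith)
    exact ⟨u' + v', add_mem hu1 hv1, by rw [mul_add, ← hu2, ← hv2]⟩

lemma Qall_red {p : R[X]} (hp : 0 < p.natDegree) {w : R[X]} (hw : w ∈ Qall R) :
    ∃ w' ∈ Qn (R := R) p.natDegree, p ∣ w - w' := by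
  induction hw using AddSubmonoid.closure_induction with
  | mem w hw =>
    obtain ⟨s, hs, h, rfl⟩ := hw
    have hp' : p ≠ 0 := by rintro rfl; simp at hp
    refine ⟨C s * (h % p) ^ 2, AddSubmonoid.subset_closure ⟨s, hs, h % p, ?_, rfl⟩, ?_⟩
    · exact natDegree_mod_lt h hp.ne'
    · have := EuclideanDomain.div_add_mod h p
      refine ⟨C s * (h / p) * (h + h % p), ?_⟩
      have e : p * (h / p) = h - h % p := by rw [eq_sub_iff_add_eq]; exact this
      linear_combination (- C s * (h + h % p)) * e
  | zero => exact ⟨0, zero_mem _, by simp⟩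
  | add u v _ _ hu hv =>
    obtain ⟨u', hu1, hu2⟩ := hu
    obtain ⟨v', hv1, hv2⟩ := hv
    refine ⟨u' + v', add_mem hu1 hv1, ?_⟩
    rw [show u + v - (u' + v') = (u - u') + (v - v') by ring]
    exact dvd_add hu2 hv2

lemma Qall_mul {u v : R[X]} (hu : u ∈ Qall R) (hv : v ∈ Qall R) : u * v ∈ Qall R := by
  induction hu using AddSubmonoid.closure_induction with
  | mem u hu =>
    obtain ⟨s, hs, h, rfl⟩ := hu
    induction hv using AddSubmonoid.closure_induction with
    | mem v hv =>
      obtain ⟨t, ht, g, rfl⟩ := hv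
      exact AddSubmonoid.subset_closure ⟨s * t, mul_nonneg hs ht, h * g, by rw [C_mul]; ring⟩
    | zero => simp
    | add u v _ _ hu hv => rw [mul_add]; exact add_mem hu hv
  | zero => simp
  | add u v _ _ hu hv => rw [add_mul]; exact add_mem hu hv

lemma Qn_descent {p : R[X]} (hp : 0 < p.natDegree) {a b : R} (hab : a < b)
    (ha : p.eval a < 0) (hb : 0 < p.eval b)
    (hno : ∀ c, a < c → c < b → p.eval c ≠ 0)
    (ih : ∀ q : R[X], q.natDegree < p.natDegree → q.eval a < 0 → 0 < q.eval b →
      ∃ c, a < c ∧ c < b ∧ q.eval c = 0) :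
    ∀ (m : ℕ) (q : R[X]), q.natDegree = m → p * q ∈ Qn p.natDegree → q = 0 := by
  intro m
  induction m using Nat.strong_induction_on with
  | _ m IH =>
  intro q hq hw
  by_contra hq0
  have hp0 : p ≠ 0 := by rintro rfl; simp at hp
  have desc : ∀ c, p.eval c ≠ 0 → q.eval c = 0 → False := by
    intro c hpc hqc
    obtain ⟨w', hw', e⟩ := Qn_root hw c (by simp [hqc])
    have hcop : IsCoprime ((X - C c) ^ 2) p := by
      apply IsCoprime.pow_left
      apply (irreducible_X_sub_C c).coprime_iff_not_dvd.2
      rwa [dvd_iff_isRoot]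
    obtain ⟨q', rfl⟩ := hcop.dvd_of_dvd_mul_left ⟨w', e⟩
    have hX : (X - C c) ^ 2 ≠ 0 := pow_ne_zero 2 (X_sub_C_ne_zero c)
    have e' : p * q' = w' := mul_left_cancel₀ hX (by rw [← e]; ring)
    have hq'0 : q' ≠ 0 := right_ne_zero_of_mul hq0
    have hd : q'.natDegree < m := by
      rw [← hq, natDegree_mul hX hq'0, natDegree_pow, natDegree_X_sub_C]
      omega
    exact hq'0 (IH _ hd q' rfl (e' ▸ hw'))
  have hdeg : q.natDegree < p.natDegree := by
    have := Qn_deg hw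
    rw [natDegree_mul hp0 hq0] at this
    omega
  have h1 := Qn_nonneg hw a
  have h2 := Qn_nonneg hw b
  rw [eval_mul] at h1 h2
  have h3 : q.eval a ≤ 0 := by
    by_contra h
    push Not at h
    nlinarith [mul_pos_of_neg_of_neg ha (neg_neg_of_pos h)]
  have h4 : 0 ≤ q.eval b := nonneg_of_mul_nonneg_right h2 hb
  rcases h3.eq_or_lt with h3 | h3
  · exact desc a ha.ne h3
  rcases h4.eq_or_lt with h4 | h4
  · exact desc b hb.ne' h4.symm
  obtain ⟨c, hc1, hc2, hc3⟩ := ih q hdeg h3 h4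
  exact desc c (hno c hc1 hc2) hc3

theorem ivt_of_max {K : Type*} [Field K] [Algebra R K] [IsAlgClosed K]
    (hmax : ∀ S : Set K, PCone S → (∀ x : R, 0 ≤ x → algebraMap R K x ∈ S) →
      ∀ y ∈ S, ∃ x : R, algebraMap R K x = y) : PolyIVT R := by
  suffices H : ∀ (n : ℕ) (p : R[X]), p.natDegree = n → ∀ a b, a < b → p.eval a < 0 →
      0 < p.eval b → ∃ c, a < c ∧ c < b ∧ p.eval c = 0 by
    intro p a b hab ha hb
    exact H _ p rfl a b hab ha hb
  intro n
  induction n using Nat.strong_induction_on with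
  | _ n IH =>
  intro p hpn a b hab ha hb
  have hp0 : p ≠ 0 := by rintro rfl; simp at ha
  have hpd : 0 < p.natDegree := by
    by_contra h
    have : p.natDegree = 0 := by omega
    rw [eq_C_of_natDegree_eq_zero this] at ha hb
    simp only [eval_C] at ha hb
    linarith
  by_contra! hno
  have IH' : ∀ q : R[X], q.natDegree < p.natDegree → q.eval a < 0 → 0 < q.eval b →
      ∃ c, a < c ∧ c < b ∧ q.eval c = 0 := fun q hq h1 h2 => IH _ (hpn ▸ hq) q rfl a b hab h1 h2
  have IH2 : ∀ q : R[X], q.natDegree < p.natDegree → q.eval a * q.eval b < 0 →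
      ∃ c, a < c ∧ c < b ∧ q.eval c = 0 := by
    intro q hq h
    rcases mul_neg_iff.1 h with ⟨h1, h2⟩ | ⟨h1, h2⟩
    · obtain ⟨c, hc1, hc2, hc3⟩ := IH' (-q) (by simpa using hq) (by simpa using h1)
        (by simpa using h2)
      exact ⟨c, hc1, hc2, by simpa using hc3⟩
    · exact IH' q hq h1 h2
  have hirr : Irreducible p := by
    refine ⟨fun h => hpd.ne' (natDegree_eq_zero_of_isUnit h), ?_⟩
    intro q r hqr
    by_contra! hu
    have hq0 : q ≠ 0 := by rintro rfl; simp [hqr] at hp0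
    have hr0 : r ≠ 0 := by rintro rfl; simp [hqr] at hp0
    have hq1 : 0 < q.natDegree := natDegree_pos_iff_degree_pos.2 (degree_pos_of_ne_zero_of_nonunit hq0 hu.1)
    have hr1 : 0 < r.natDegree := natDegree_pos_iff_degree_pos.2 (degree_pos_of_ne_zero_of_nonunit hr0 hu.2)
    have hd : p.natDegree = q.natDegree + r.natDegree := by rw [hqr, natDegree_mul hq0 hr0]
    have hm := mul_neg_of_neg_of_pos ha hb
    rw [hqr, eval_mul, eval_mul] at hm
    have hm' : (q.eval a * q.eval b) * (r.eval a * r.eval b) < 0 := by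
      calc _ = _ := by ring
        _ < 0 := hm
    rcases mul_neg_iff.1 hm' with ⟨-, h2⟩ | ⟨h1, -⟩
    · obtain ⟨c, hc1, hc2, hc3⟩ := IH2 r (by omega) h2
      exact hno c hc1 hc2 (by simp [hqr, hc3])
    · obtain ⟨c, hc1, hc2, hc3⟩ := IH2 q (by omega) h1
      exact hno c hc1 hc2 (by simp [hqr, hc3])
  obtain ⟨α, hα⟩ := IsAlgClosed.exists_aeval_eq_zero K p
    ((natDegree_pos_iff_degree_pos.1 hpd).ne')
  have hdvd : ∀ u : R[X], aeval α u = 0 → p ∣ u := by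
    intro u hu
    by_contra h
    obtain ⟨x, y, hxy⟩ := hirr.coprime_iff_not_dvd.2 h
    have := congrArg (aeval α) hxy
    simp [hα, hu] at this
  have hcone : PCone ((aeval α : R[X] →ₐ[R] K) '' (Qall R : Set R[X])) := by
    refine ⟨?_, ?_, ?_, ?_⟩
    · rintro _ ⟨u, hu, rfl⟩ _ ⟨v, hv, rfl⟩
      exact ⟨u + v, add_mem hu hv, by simp⟩
    · rintro _ ⟨u, hu, rfl⟩ _ ⟨v, hv, rfl⟩
      exact ⟨u * v, Qall_mul hu hv, by simp⟩
    · rintro _ ⟨u, hu, rfl⟩ _ ⟨v, hv, rfl⟩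
      exact ⟨(u - v) ^ 2, AddSubmonoid.subset_closure ⟨1, zero_le_one, u - v, by simp⟩, by simp⟩
    · rintro _ ⟨u, hu, rfl⟩ ⟨v, hv, huv⟩
      obtain ⟨u', hu', u1, eu⟩ := Qall_red hpd hu
      obtain ⟨v', hv', v1, ev⟩ := Qall_red hpd hv
      have e1 : aeval α u = aeval α u' := by
        have := congrArg (aeval α) eu
        simpa [hα, sub_eq_zero] using this
      have e2 : aeval α v = aeval α v' := by
        have := congrArg (aeval α) ev
        simpa [hα, sub_eq_zero] using this
      obtain ⟨q, hq⟩ := hdvd (u' + v') (by rw [map_add, ← e1, ← e2, huv]; ring)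
      have hw : u' + v' ∈ Qn p.natDegree := add_mem hu' hv'
      rw [hq] at hw
      have := Qn_descent hpd hab ha hb hno IH' _ q rfl hw
      rw [this, mul_zero] at hq
      have hu0 : u' = 0 := by
        apply Polynomial.funext
        intro x
        have h1 := Qn_nonneg hu' x
        have h2 := Qn_nonneg hv' x
        have h3 := congrArg (eval x) hq
        rw [eval_add, eval_zero] at h3
        rw [eval_zero]
        linarith
      rw [e1, hu0, map_zero]
  have hext := hmax _ hcone (by
    intro x hx
    exact ⟨C x, AddSubmonoid.subset_closure ⟨x, hx, 1, by simp⟩, by simp⟩)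
  obtain ⟨x, hx⟩ := hext ((α + 1) ^ 2) ⟨(X + 1) ^ 2,
    AddSubmonoid.subset_closure ⟨1, zero_le_one, X + 1, by simp⟩, by simp⟩
  obtain ⟨y, hy⟩ := hext ((α - 1) ^ 2) ⟨(X - 1) ^ 2,
    AddSubmonoid.subset_closure ⟨1, zero_le_one, X - 1, by simp⟩, by simp⟩
  have h4 : algebraMap R K 4 ≠ 0 := by
    rw [_root_.map_ne_zero]; norm_num
  have hαR : algebraMap R K ((x - y) / 4) = α := by
    rw [map_div₀, div_eq_iff h4, map_sub, hx, hy, map_ofNat]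
    ring
  have hroot : p.eval ((x - y) / 4) = 0 := by
    have : algebraMap R K (p.eval ((x - y) / 4)) = 0 := by
      rw [← hαR, aeval_algebraMap_apply] at hα
      simpa using hα
    simpa using this
  have hd1 := degree_eq_one_of_irreducible_of_root hirr hroot
  generalize (x - y) / 4 = r at hroot
  have hlin : ∀ z, p.eval z = p.coeff 1 * (z - r) := by
    intro z
    rw [eq_X_add_C_of_degree_le_one hd1.le] at hroot ⊢
    simp at hroot ⊢
    linear_combination hroot
  rw [hlin] at ha hb
  rcases lt_trichotomy (p.coeff 1) 0 with h | h | h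
  · have := (mul_neg_iff.1 ha); have := (mul_pos_iff.1 hb)
    have : r < a := by nlinarith
    have : b < r := by nlinarith
    linarith
  · simp [h] at ha
  · exact hno r (by nlinarith) (by nlinarith) hroot
end ivt

end part5


section part6
open Polynomial

section pcone
variable {K : Type*} [Field K]

theorem exists_max_cone (S₀ : Set K) (h₀ : PCone S₀) :
    ∃ S, S₀ ⊆ S ∧ PCone S ∧ ∀ S', PCone S' → S ⊆ S' → S' = S := by
  obtain ⟨S, hS, hmax⟩ := zorn_subset_nonempty {S : Set K | PCone S} (by
    intro c hc hch ⟨s₀, hs₀⟩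
    refine ⟨⋃₀ c, ?_, fun s hs => Set.subset_sUnion_of_mem hs⟩
    have two : ∀ x ∈ ⋃₀ c, ∀ y ∈ ⋃₀ c, ∃ s ∈ c, x ∈ s ∧ y ∈ s := by
      rintro x ⟨s, hs, hx⟩ y ⟨t, ht, hy⟩
      rcases hch.total hs ht with h | h
      · exact ⟨t, ht, h hx, hy⟩
      · exact ⟨s, hs, hx, h hy⟩
    refine ⟨?_, ?_, ?_, ?_⟩
    · intro x hx y hy
      obtain ⟨s, hs, h1, h2⟩ := two x hx y hy
      exact ⟨s, hs, (hc hs).add x h1 y h2⟩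
    · intro x hx y hy
      obtain ⟨s, hs, h1, h2⟩ := two x hx y hy
      exact ⟨s, hs, (hc hs).mul x h1 y h2⟩
    · intro x hx y hy
      obtain ⟨s, hs, h1, h2⟩ := two x hx y hy
      exact ⟨s, hs, (hc hs).sq x h1 y h2⟩
    · intro x hx hy
      obtain ⟨s, hs, h1, h2⟩ := two x hx _ hy
      exact (hc hs).supp x h1 h2) S₀ h₀
  refine ⟨S, hS, hmax.prop, fun S' h1 h2 => ?_⟩
  exact (Set.Subset.antisymm h2 (hmax.le_of_ge h1 h2)).symm

theorem exists_rcf_of_cone [IsAlgClosed K] (S₀ : Set K) (h₀ : PCone S₀) (one₀ : (1:K) ∈ S₀) :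
    ∃ (R : Subfield K) (_ : LinearOrder R) (_ : IsStrictOrderedRing R), PolyIVT R ∧
      ∀ x ∈ S₀, ∃ y : R, 0 ≤ y ∧ (y : K) = x := by
  obtain ⟨S, hS, hc, hmax⟩ := exists_max_cone S₀ h₀
  have one : (1:K) ∈ S := hS one₀
  have zero : (0:K) ∈ S := by simpa using hc.sq 1 one 1 one
  have pow : ∀ a ∈ S, ∀ n : ℕ, a ^ n ∈ S := by
    intro a ha n
    induction n with
    | zero => simpa using one
    | succ n ih => rw [pow_succ]; exact hc.mul _ ih _ ha
  have sum0 : ∀ a ∈ S, ∀ b ∈ S, a + b = 0 → a = 0 := by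
    intro a ha b hb hab
    apply hc.supp a ha
    rwa [neg_eq_of_add_eq_zero_right hab]
  have inv : ∀ a ∈ S, a⁻¹ ∈ S := by
    intro a ha
    by_cases ha0 : a = 0
    · simpa [ha0] using zero
    have hS' : PCone {x : K | ∃ s ∈ S, ∃ n : ℕ, x = s / a ^ n} := by
      refine ⟨?_, ?_, ?_, ?_⟩
      · rintro _ ⟨s, hs, n, rfl⟩ _ ⟨t, ht, m, rfl⟩
        exact ⟨s * a ^ m + t * a ^ n, hc.add _ (hc.mul _ hs _ (pow a ha m)) _
          (hc.mul _ ht _ (pow a ha n)), n + m, by field_simp; ring⟩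
      · rintro _ ⟨s, hs, n, rfl⟩ _ ⟨t, ht, m, rfl⟩
        exact ⟨s * t, hc.mul _ hs _ ht, n + m, by field_simp; ring⟩
      · rintro _ ⟨s, hs, n, rfl⟩ _ ⟨t, ht, m, rfl⟩
        exact ⟨(s * a ^ m - t * a ^ n) ^ 2, hc.sq _ (hc.mul _ hs _ (pow a ha m)) _
          (hc.mul _ ht _ (pow a ha n)), 2 * (n + m), by field_simp; ring⟩
      · rintro _ ⟨s, hs, n, rfl⟩ ⟨t, ht, m, h⟩
        have h' : s * a ^ m + t * a ^ n = 0 := by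
          field_simp at h
          linear_combination -h
        have := sum0 _ (hc.mul _ hs _ (pow a ha m)) _ (hc.mul _ ht _ (pow a ha n)) h'
        simp [ha0] at this
        simp [this]
    rw [← hmax _ hS' (fun s hs => ⟨s, hs, 0, by simp⟩)]
    exact ⟨1, one, 1, by simp⟩
  let R : Subfield K :=
    { carrier := {x | ∃ a ∈ S, ∃ b ∈ S, x = a - b}
      mul_mem' := by
        rintro _ _ ⟨a, ha, b, hb, rfl⟩ ⟨c, hc', d, hd, rfl⟩
        exact ⟨a * c + b * d, hc.add _ (hc.mul _ ha _ hc') _ (hc.mul _ hb _ hd),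
          a * d + b * c, hc.add _ (hc.mul _ ha _ hd) _ (hc.mul _ hb _ hc'), by ring⟩
      one_mem' := ⟨1, one, 0, zero, by simp⟩
      add_mem' := by
        rintro _ _ ⟨a, ha, b, hb, rfl⟩ ⟨c, hc', d, hd, rfl⟩
        exact ⟨a + c, hc.add _ ha _ hc', b + d, hc.add _ hb _ hd, by ring⟩
      zero_mem' := ⟨0, zero, 0, zero, by simp⟩
      neg_mem' := by
        rintro _ ⟨a, ha, b, hb, rfl⟩
        exact ⟨b, hb, a, ha, by ring⟩
      inv_mem' := by
        rintro _ ⟨a, ha, b, hb, rfl⟩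
        have h := inv _ (hc.sq a ha b hb)
        refine ⟨a * ((a - b) ^ 2)⁻¹, hc.mul _ ha _ h, b * ((a - b) ^ 2)⁻¹, hc.mul _ hb _ h, ?_⟩
        by_cases h0 : a - b = 0
        · simp [h0]
        · field_simp }
  have hSR : ∀ x ∈ S, x ∈ R := fun x hx => ⟨x, hx, 0, zero, by simp⟩
  have sqR : ∀ x ∈ R, x ^ 2 ∈ S := by
    rintro _ ⟨a, ha, b, hb, rfl⟩
    exact hc.sq a ha b hb
  have tot : ∀ r ∈ R, r ∈ S ∨ -r ∈ S := by
    intro r hr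
    by_contra! hn
    apply hn.2
    have hS' : PCone {x : K | ∃ s ∈ S, ∃ t ∈ S, x = s - r * t} := by
      refine ⟨?_, ?_, ?_, ?_⟩
      · rintro _ ⟨s, hs, t, ht, rfl⟩ _ ⟨s', hs', t', ht', rfl⟩
        exact ⟨s + s', hc.add _ hs _ hs', t + t', hc.add _ ht _ ht', by ring⟩
      · rintro _ ⟨s, hs, t, ht, rfl⟩ _ ⟨s', hs', t', ht', rfl⟩
        exact ⟨s * s' + r ^ 2 * (t * t'), hc.add _ (hc.mul _ hs _ hs') _
          (hc.mul _ (sqR r hr) _ (hc.mul _ ht _ ht')), s * t' + t * s',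
          hc.add _ (hc.mul _ hs _ ht') _ (hc.mul _ ht _ hs'), by ring⟩
      · rintro _ ⟨s, hs, t, ht, rfl⟩ _ ⟨s', hs', t', ht', rfl⟩
        refine ⟨_, sqR _ ?_, 0, zero, by rw [mul_zero, sub_zero]⟩
        exact sub_mem (sub_mem (hSR _ hs) (mul_mem hr (hSR _ ht)))
          (sub_mem (hSR _ hs') (mul_mem hr (hSR _ ht')))
      · rintro _ ⟨s, hs, t, ht, rfl⟩ ⟨s', hs', t', ht', h⟩
        have e : s + s' = r * (t + t') := by linear_combination -h
        have ht0 : t + t' = 0 := by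
          by_contra h0
          apply hn.1
          have : r = (s + s') * (t + t')⁻¹ := by rw [e]; field_simp
          rw [this]
          exact hc.mul _ (hc.add _ hs _ hs') _ (inv _ (hc.add _ ht _ ht'))
        have t0 := sum0 t ht t' ht' ht0
        rw [ht0, mul_zero] at e
        have s0 := sum0 s hs s' hs' e
        simp [t0, s0]
    rw [← hmax _ hS' (fun s hs => ⟨s, hs, 0, zero, by simp⟩)]
    exact ⟨0, zero, 1, one, by simp⟩
  classical
  let lo : LinearOrder R :=
    { le := fun x y => (y : K) - x ∈ S
      le_refl := fun x => by simpa using zero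
      le_trans := fun x y z h1 h2 => by
        have := hc.add _ h1 _ h2
        simpa using this
      le_antisymm := fun x y h1 h2 => by
        have := hc.supp _ h1 (by simpa using h2)
        exact Subtype.ext (sub_eq_zero.1 this).symm
      le_total := fun x y => by
        rcases tot _ (sub_mem y.2 x.2) with h | h
        · exact Or.inl h
        · right
          simpa using h
      toDecidableLE := Classical.decRel _ }
  have le_iff : ∀ x y : R, x ≤ y ↔ (y : K) - x ∈ S := fun x y => Iff.rfl
  have sor : IsStrictOrderedRing R := by
    have h1 : IsOrderedAddMonoid R := ⟨fun x y h z => by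
      rw [le_iff] at h ⊢
      simpa using h, fun x y h z => by
      rw [le_iff] at h ⊢
      simpa using h⟩
    have h2 : ZeroLEOneClass R := ⟨by rw [le_iff]; simpa using one⟩
    refine IsStrictOrderedRing.of_mul_pos ?_
    intro a b ha hb
    have ha' := ha.le
    have hb' := hb.le
    rw [le_iff] at ha' hb'
    refine lt_of_le_of_ne ?_ (mul_ne_zero ha.ne' hb.ne').symm
    rw [le_iff]
    simpa using hc.mul _ ha' _ hb'
  refine ⟨R, lo, sor, ?_, ?_⟩
  · refine ivt_of_max (K := K) ?_
    intro S' hS' hle y hy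
    have : S' = S := hmax S' hS' (fun x hx => hle ⟨x, hSR x hx⟩ (by rw [le_iff]; simpa using hx))
    rw [this] at hy
    exact ⟨⟨y, hSR y hy⟩, rfl⟩
  · intro x hx
    exact ⟨⟨x, hSR x (hS hx)⟩, by rw [le_iff]; simpa using hS hx, rfl⟩
end pcone

section pre
universe uA
variable {A : Type uA} [CommRing A]

structure PPre (P : Set A) : Prop where
  add : ∀ x ∈ P, ∀ y ∈ P, x + y ∈ P
  mul : ∀ x ∈ P, ∀ y ∈ P, x * y ∈ P
  sq : ∀ x, x ^ 2 ∈ P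
  neg : -1 ∉ P

theorem exists_max_pre (S₀ : Set A) (h₀ : PPre S₀) :
    ∃ S, S₀ ⊆ S ∧ PPre S ∧ ∀ S', PPre S' → S ⊆ S' → S' = S := by
  obtain ⟨S, hS, hmax⟩ := zorn_subset_nonempty {S : Set A | PPre S} (by
    intro c hc hch ⟨s₀, hs₀⟩
    refine ⟨⋃₀ c, ?_, fun s hs => Set.subset_sUnion_of_mem hs⟩
    have two : ∀ x ∈ ⋃₀ c, ∀ y ∈ ⋃₀ c, ∃ s ∈ c, x ∈ s ∧ y ∈ s := by
      rintro x ⟨s, hs, hx⟩ y ⟨t, ht, hy⟩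
      rcases hch.total hs ht with h | h
      · exact ⟨t, ht, h hx, hy⟩
      · exact ⟨s, hs, hx, h hy⟩
    refine ⟨?_, ?_, ?_, ?_⟩
    · intro x hx y hy
      obtain ⟨s, hs, h1, h2⟩ := two x hx y hy
      exact ⟨s, hs, (hc hs).add x h1 y h2⟩
    · intro x hx y hy
      obtain ⟨s, hs, h1, h2⟩ := two x hx y hy
      exact ⟨s, hs, (hc hs).mul x h1 y h2⟩
    · intro x
      exact ⟨s₀, hs₀, (hc hs₀).sq x⟩
    · rintro ⟨s, hs, h⟩
      exact (hc hs).neg h) S₀ h₀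
  refine ⟨S, hS, hmax.prop, fun S' h1 h2 => ?_⟩
  exact (Set.Subset.antisymm h2 (hmax.le_of_ge h1 h2)).symm

theorem exists_rcf_of_pre (P₀ : Set A) (h₀ : PPre P₀) :
    ∃ (R : Type uA) (_ : Field R) (_ : LinearOrder R) (_ : IsStrictOrderedRing R) (ψ : A →+* R),
      PolyIVT R ∧ ∀ x ∈ P₀, 0 ≤ ψ x := by
  obtain ⟨P, hP, hp, hmax⟩ := exists_max_pre P₀ h₀
  have one : (1:A) ∈ P := by simpa using hp.sq 1
  have zero : (0:A) ∈ P := by simpa using hp.sq 0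
  have key : ∀ a, a ∉ P → ∃ s ∈ P, ∃ t ∈ P, -1 = s + a * t := by
    intro a ha
    by_contra! hn
    apply ha
    have : PPre {x : A | ∃ s ∈ P, ∃ t ∈ P, x = s + a * t} := by
      refine ⟨?_, ?_, ?_, ?_⟩
      · rintro _ ⟨s, hs, t, ht, rfl⟩ _ ⟨s', hs', t', ht', rfl⟩
        exact ⟨s + s', hp.add _ hs _ hs', t + t', hp.add _ ht _ ht', by ring⟩
      · rintro _ ⟨s, hs, t, ht, rfl⟩ _ ⟨s', hs', t', ht', rfl⟩
        exact ⟨s * s' + a ^ 2 * (t * t'), hp.add _ (hp.mul _ hs _ hs') _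
          (hp.mul _ (hp.sq a) _ (hp.mul _ ht _ ht')), s * t' + t * s',
          hp.add _ (hp.mul _ hs _ ht') _ (hp.mul _ ht _ hs'), by ring⟩
      · intro x
        exact ⟨x ^ 2, hp.sq x, 0, zero, by simp⟩
      · rintro ⟨s, hs, t, ht, h⟩
        exact hn s hs t ht h
    rw [← hmax _ this (fun s hs => ⟨s, hs, 0, zero, by simp⟩)]
    exact ⟨0, zero, 1, one, by simp⟩
  have key2 : ∀ a b, a ∉ P → b ∉ P → -(a * b) ∉ P := by
    intro a b ha hb hab
    obtain ⟨s, hs, t, ht, h1⟩ := key a ha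
    obtain ⟨s', hs', t', ht', h2⟩ := key b hb
    apply hp.neg
    have : (-1 : A) = s + s' + s * s' + -(a * b) * (t * t') := by
      linear_combination (1 + s') * h1 - (a * t) * h2
    rw [this]
    exact hp.add _ (hp.add _ (hp.add _ hs _ hs') _ (hp.mul _ hs _ hs')) _
      (hp.mul _ hab _ (hp.mul _ ht _ ht'))
  have tot : ∀ a, a ∈ P ∨ -a ∈ P := by
    intro a
    by_contra! hn
    apply key2 _ _ hn.1 hn.2
    have := hp.sq a
    rwa [show -(a * -a) = a ^ 2 by ring]
  let I : Ideal A :=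
    { carrier := {x | x ∈ P ∧ -x ∈ P}
      add_mem' := by
        rintro a b ⟨h1, h2⟩ ⟨h3, h4⟩
        exact ⟨hp.add _ h1 _ h3, by rw [neg_add]; exact hp.add _ h2 _ h4⟩
      zero_mem' := ⟨zero, by simpa using zero⟩
      smul_mem' := by
        rintro c x ⟨h1, h2⟩
        rw [smul_eq_mul]
        rcases tot c with h | h
        · exact ⟨hp.mul _ h _ h1, by rw [← mul_neg]; exact hp.mul _ h _ h2⟩
        · exact ⟨by rw [← neg_mul_neg]; exact hp.mul _ h _ h2,
            by rw [← neg_mul]; exact hp.mul _ h _ h1⟩ }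
  have memI : ∀ x, x ∈ I ↔ x ∈ P ∧ -x ∈ P := fun x => Iff.rfl
  have hI : I.IsPrime := by
    constructor
    · rw [Ideal.ne_top_iff_one, memI]
      exact fun h => hp.neg h.2
    · intro x y hxy
      rw [memI] at hxy
      by_contra! hn
      rw [memI, memI] at hn
      have hx : x ∉ P ∨ -x ∉ P := by tauto
      have hy : y ∉ P ∨ -y ∉ P := by tauto
      rcases hx with hx | hx <;> rcases hy with hy | hy
      · exact key2 _ _ hx hy hxy.2
      · exact key2 _ _ hx hy (by simpa using hxy.1)
      · exact key2 _ _ hx hy (by simpa using hxy.1)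
      · exact key2 _ _ hx hy (by simpa using hxy.2)
  let K := AlgebraicClosure (FractionRing (A ⧸ I))
  let φ : A →+* K := ((algebraMap (FractionRing (A ⧸ I)) K).comp
    (algebraMap (A ⧸ I) (FractionRing (A ⧸ I)))).comp (Ideal.Quotient.mk I)
  have hφ : ∀ x, φ x = 0 ↔ x ∈ I := by
    intro x
    simp only [φ, RingHom.comp_apply]
    rw [map_eq_zero_iff _ (RingHom.injective _),
      map_eq_zero_iff _ (IsFractionRing.injective (A ⧸ I) (FractionRing (A ⧸ I))),
      Ideal.Quotient.eq_zero_iff_mem]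
  obtain ⟨R, lo, so, hR, hS⟩ := exists_rcf_of_cone (φ '' P) (by
    refine ⟨?_, ?_, ?_, ?_⟩
    · rintro _ ⟨u, hu, rfl⟩ _ ⟨v, hv, rfl⟩
      exact ⟨u + v, hp.add _ hu _ hv, by simp⟩
    · rintro _ ⟨u, hu, rfl⟩ _ ⟨v, hv, rfl⟩
      exact ⟨u * v, hp.mul _ hu _ hv, by simp⟩
    · rintro _ ⟨u, hu, rfl⟩ _ ⟨v, hv, rfl⟩
      exact ⟨(u - v) ^ 2, hp.sq _, by simp⟩
    · rintro _ ⟨u, hu, rfl⟩ ⟨v, hv, h⟩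
      have : u + v ∈ I := by rw [← hφ, map_add, h]; ring
      rw [hφ, memI]
      refine ⟨hu, ?_⟩
      have := hp.add _ this.2 _ hv
      rwa [show -(u + v) + v = -u by ring] at this) ⟨1, one, by simp⟩
  have hmem : ∀ x, φ x ∈ R := by
    intro x
    rcases tot x with h | h
    · obtain ⟨y, -, hy⟩ := hS _ ⟨x, h, rfl⟩
      rw [← hy]; exact y.2
    · obtain ⟨y, -, hy⟩ := hS _ ⟨-x, h, rfl⟩
      rw [map_neg] at hy
      rw [← neg_neg (φ x), ← hy]
      exact neg_mem y.2
  refine ⟨R, inferInstance, lo, so, φ.codRestrict R hmem, hR, ?_⟩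
  intro x hx
  obtain ⟨y, h0, hy⟩ := hS _ ⟨x, hP hx, rfl⟩
  have : φ.codRestrict R hmem x = y := Subtype.ext hy.symm
  rw [this]
  exact h0
end pre

end part6


section part7

section stengle
open MvPolynomial
variable {d k : ℕ} (f : Fin k → MvPolynomial (Fin d) ℝ) (T : Set (MvPolynomial (Fin d) ℝ))
  (hadd : ∀ x ∈ T, ∀ y ∈ T, x + y ∈ T) (hmul : ∀ x ∈ T, ∀ y ∈ T, x * y ∈ T)
  (hsq : ∀ x, x ^ 2 ∈ T) (hf : ∀ i, f i ∈ T)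

include hadd hmul hsq hf

theorem stengle (p : MvPolynomial (Fin d) ℝ)
    (hpos : ∀ a : Fin d → ℝ, (∀ i, 0 ≤ eval a (f i)) → 0 < eval a p) :
    ∃ s ∈ T, ∃ t ∈ T, p * s = 1 + t := by
  classical
  by_contra! hn
  have zero : (0 : MvPolynomial (Fin d) ℝ) ∈ T := by simpa using hsq 0
  have one : (1 : MvPolynomial (Fin d) ℝ) ∈ T := by simpa using hsq 1
  have hpre : PPre {x | ∃ s ∈ T, ∃ t ∈ T, x = s - p * t} := by
    refine ⟨?_, ?_, ?_, ?_⟩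
    · rintro _ ⟨s, hs, t, ht, rfl⟩ _ ⟨s', hs', t', ht', rfl⟩
      exact ⟨s + s', hadd _ hs _ hs', t + t', hadd _ ht _ ht', by ring⟩
    · rintro _ ⟨s, hs, t, ht, rfl⟩ _ ⟨s', hs', t', ht', rfl⟩
      exact ⟨s * s' + p ^ 2 * (t * t'), hadd _ (hmul _ hs _ hs') _
          (hmul _ (hsq p) _ (hmul _ ht _ ht')), s * t' + t * s',
          hadd _ (hmul _ hs _ ht') _ (hmul _ ht _ hs'), by ring⟩
    · intro x
      exact ⟨x ^ 2, hsq x, 0, zero, by simp⟩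
    · rintro ⟨s, hs, t, ht, h⟩
      exact hn t ht s hs (by linear_combination h)
  obtain ⟨O, _, _, _, ψ, hO, hψ⟩ := exists_rcf_of_pre _ hpre
  obtain ⟨a, ha⟩ := sign_realize hO (ψ.comp C) d (fun i => ψ (X i))
    (insert p (Finset.univ.image f))
  have e : eval₂Hom (ψ.comp C) (fun i => ψ (X i)) = ψ := by
    apply MvPolynomial.ringHom_ext <;> intro <;> simp
  rw [e] at ha
  have h1 : ∀ i, 0 ≤ eval a (f i) := by
    intro i
    rw [← sign_nonneg_iff, ha (f i) (by simp), sign_nonneg_iff]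
    exact hψ _ ⟨f i, hf i, 0, zero, by simp⟩
  have h2 : eval a p ≤ 0 := by
    rw [← sign_nonpos_iff, ha p (by simp), sign_nonpos_iff]
    have := hψ (-p) ⟨0, zero, 1, one, by simp⟩
    rw [map_neg] at this
    linarith
  exact absurd (hpos a h1) (not_lt.2 h2)
end stengle

section arch
open MvPolynomial
variable {d : ℕ}

theorem arch (M : Set (MvPolynomial (Fin d) ℝ))
    (hadd : ∀ x ∈ M, ∀ y ∈ M, x + y ∈ M) (hsm : ∀ q, ∀ x ∈ M, q ^ 2 * x ∈ M)
    (hone : 1 ∈ M) (N : ℝ) (hN : 0 ≤ N) (hg : C N - ∑ i, X i ^ 2 ∈ M)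
    (p : MvPolynomial (Fin d) ℝ) : ∃ c : ℝ, 0 ≤ c ∧ C c - p ∈ M := by
  have smul : ∀ r : ℝ, 0 ≤ r → ∀ x ∈ M, C r * x ∈ M := by
    intro r hr x hx
    have := hsm (C (√r)) x hx
    rwa [← C_pow, Real.sq_sqrt hr] at this
  have sq : ∀ q : MvPolynomial (Fin d) ℝ, q ^ 2 ∈ M := fun q => by simpa using hsm q 1 hone
  have zero : (0 : MvPolynomial (Fin d) ℝ) ∈ M := by simpa using sq 0
  have Bmul : ∀ p q : MvPolynomial (Fin d) ℝ, (∃ c : ℝ, 0 ≤ c ∧ C c - p ^ 2 ∈ M) →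
      (∃ c : ℝ, 0 ≤ c ∧ C c - q ^ 2 ∈ M) → ∃ c : ℝ, 0 ≤ c ∧ C c - (p * q) ^ 2 ∈ M := by
    rintro p q ⟨c, hc, h⟩ ⟨c', hc', h'⟩
    refine ⟨c * c', by positivity, ?_⟩
    have := hadd _ (smul c' hc' _ h) _ (hsm p _ h')
    convert this using 1
    rw [C_mul]; ring
  have B : ∀ p : MvPolynomial (Fin d) ℝ, ∃ c : ℝ, 0 ≤ c ∧ C c - p ^ 2 ∈ M := by
    intro p
    induction p using MvPolynomial.induction_on with
    | C r => exact ⟨r ^ 2, by positivity, by simpa using zero⟩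
    | add p q hp hq =>
      obtain ⟨c, hc, h⟩ := hp
      obtain ⟨c', hc', h'⟩ := hq
      refine ⟨2 * c + 2 * c', by positivity, ?_⟩
      have := hadd _ (hadd _ (smul 2 (by norm_num) _ h) _ (smul 2 (by norm_num) _ h'))
        _ (sq (p - q))
      convert this using 1
      simp only [C_add, C_mul, map_ofNat]
      ring
    | mul_X p i hp =>
      refine Bmul p (X i) hp ⟨N, hN, ?_⟩
      have hsum : ∀ s : Finset (Fin d), ∑ j ∈ s, (X j : MvPolynomial (Fin d) ℝ) ^ 2 ∈ M := by
        classical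
        intro s
        induction s using Finset.induction_on with
        | empty => simpa using zero
        | insert a s ha ih => rw [Finset.sum_insert ha]; exact hadd _ (sq _) _ ih
      have := hadd _ hg _ (hsum (Finset.univ.erase i))
      convert this using 1
      rw [← Finset.add_sum_erase Finset.univ _ (Finset.mem_univ i)]
      ring
  obtain ⟨c, hc, h⟩ := B p
  refine ⟨(c + 1) / 2, by positivity, ?_⟩
  have := smul (1 / 2) (by norm_num) _ (hadd _ h _ (sq (1 - p)))
  convert this using 1
  have e2 : (C (1 / 2 : ℝ) : MvPolynomial (Fin d) ℝ) * 2 = 1 := by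
    rw [show (2 : MvPolynomial (Fin d) ℝ) = C 2 from (map_ofNat C 2).symm, ← C_mul]; norm_num
  have e3 : (C ((c + 1) / 2) : MvPolynomial (Fin d) ℝ) = C (1 / 2) * (C c + 1) := by
    rw [show (1 : MvPolynomial (Fin d) ℝ) = C 1 by simp, ← C_add, ← C_mul]; congr 1; ring
  rw [e3]
  linear_combination p * e2

variable {k : ℕ} (f : Fin k → MvPolynomial (Fin d) ℝ) (T : Set (MvPolynomial (Fin d) ℝ))
  (hadd : ∀ x ∈ T, ∀ y ∈ T, x + y ∈ T) (hmul : ∀ x ∈ T, ∀ y ∈ T, x * y ∈ T)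
  (hsq : ∀ x, x ^ 2 ∈ T) (hf : ∀ i, f i ∈ T)
  (hK : ∃ N : ℝ, 0 ≤ N ∧ ∀ a : Fin d → ℝ, (∀ i, 0 ≤ eval a (f i)) → ∑ i, a i ^ 2 < N)

include hadd hmul hsq hf hK

theorem T_arch (p : MvPolynomial (Fin d) ℝ) : ∃ c : ℝ, 0 ≤ c ∧ C c - p ∈ T := by
  obtain ⟨N, hN, hNK⟩ := hK
  have one : (1 : MvPolynomial (Fin d) ℝ) ∈ T := by simpa using hsq 1
  have zero : (0 : MvPolynomial (Fin d) ℝ) ∈ T := by simpa using hsq 0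
  have hC : ∀ r : ℝ, 0 ≤ r → (C r : MvPolynomial (Fin d) ℝ) ∈ T := by
    intro r hr
    have := hsq (C (√r))
    rwa [← C_pow, Real.sq_sqrt hr] at this
  have hS : ∀ x : MvPolynomial (Fin d) ℝ, IsSumSq x → x ∈ T := by
    intro x hx
    induction hx with
    | zero => exact zero
    | sq_add a hs ih => exact hadd _ (by rw [← _root_.sq]; exact hsq a) _ ih
  obtain ⟨g, hg⟩ : ∃ g : MvPolynomial (Fin d) ℝ, g = C N - ∑ i, X i ^ 2 := ⟨_, rfl⟩
  obtain ⟨s, hs, t, ht, hst⟩ := stengle f T hadd hmul hsq hf g (by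
    intro a ha
    have := hNK a ha
    rw [hg]
    simp only [map_sub, eval_C, map_sum, map_pow, eval_X]
    linarith)
  have sqS : ∀ q : MvPolynomial (Fin d) ℝ, IsSumSq (q ^ 2) := fun q => by
    rw [_root_.sq]; exact IsSumSq.mul_self q
  obtain ⟨m, hm, σ, τ, hσ, hτ, hmt⟩ := arch
    {x | ∃ σ τ, IsSumSq σ ∧ IsSumSq τ ∧ x = σ + g * τ} (by
      rintro _ ⟨σ, τ, h1, h2, rfl⟩ _ ⟨σ', τ', h1', h2', rfl⟩
      exact ⟨_, _, h1.add h1', h2.add h2', by ring⟩) (by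
      rintro q _ ⟨σ, τ, h1, h2, rfl⟩
      exact ⟨_, _, (sqS q).mul h1, (sqS q).mul h2, by ring⟩)
      ⟨1, 0, by simpa using sqS 1, IsSumSq.zero, by simp⟩ N hN
      ⟨0, 1, IsSumSq.zero, by simpa using sqS 1, by rw [hg]; ring⟩ t
  have h1t : 1 + t ∈ T := hadd _ one _ ht
  have hgt : (1 + t) * g ∈ T := by
    rw [← hst, show g * s * g = g ^ 2 * s by ring]
    exact hmul _ (hsq g) _ hs
  have h1 : (1 + t) * (C m - t) ∈ T := by
    rw [hmt, mul_add, ← mul_assoc]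
    exact hadd _ (hmul _ h1t _ (hS _ hσ)) _ (hmul _ hgt _ (hS _ hτ))
  have h2 : C (m + m ^ 2 / 4) - t ∈ T := by
    have := hadd _ h1 _ (hsq (C (m / 2) - t))
    convert this using 1
    have e1 : (C (m + m ^ 2 / 4) : MvPolynomial (Fin d) ℝ) = C m + C (m / 2) ^ 2 := by
      rw [← C_pow, ← C_add]; congr 1; ring
    have e2 : (C m : MvPolynomial (Fin d) ℝ) = 2 * C (m / 2) := by
      rw [show (2 : MvPolynomial (Fin d) ℝ) = C 2 from (map_ofNat C 2).symm, ← C_mul]; congr 1; ring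
    rw [e1, e2]
    ring
  have hsum : ∀ s : Finset (Fin d), ∑ j ∈ s, (X j : MvPolynomial (Fin d) ℝ) ^ 2 ∈ T := by
    classical
    intro s
    induction s using Finset.induction_on with
    | empty => simpa using zero
    | insert a s ha ih => rw [Finset.sum_insert ha]; exact hadd _ (hsq _) _ ih
  refine arch T hadd (fun q x hx => hmul _ (hsq q) _ hx) one
    (N + N * (m + m ^ 2 / 4)) (by positivity) ?_ p
  have := hadd _ (hadd _ hgt _ (hmul _ ht _ (hsum Finset.univ))) _ (hmul _ (hC N hN) _ h2)
  convert this using 1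
  rw [hg, C_add, C_mul]
  ring

theorem T_pos (p : MvPolynomial (Fin d) ℝ)
    (hpos : ∀ a : Fin d → ℝ, (∀ i, 0 ≤ eval a (f i)) → 0 < eval a p) : p ∈ T := by
  have A := T_arch f T hadd hmul hsq hf hK
  have hC : ∀ r : ℝ, 0 ≤ r → (C r : MvPolynomial (Fin d) ℝ) ∈ T := by
    intro r hr
    have := hsq (C (√r))
    rwa [← C_pow, Real.sq_sqrt hr] at this
  obtain ⟨s, hs, t, ht, hst⟩ := stengle f T hadd hmul hsq hf p hpos
  obtain ⟨k₀, hk₀, hks₀⟩ := A s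
  obtain ⟨k, hk, hks⟩ : ∃ k : ℝ, 0 < k ∧ C k - s ∈ T := by
    refine ⟨k₀ + 1, by linarith, ?_⟩
    have := hadd _ hks₀ _ (hC 1 zero_le_one)
    convert this using 1
    rw [C_add]; ring
  obtain ⟨r₀, hr₀, hr⟩ := A (-p)
  rw [sub_neg_eq_add, add_comm] at hr
  have fin : ∀ r : ℝ, r ≤ 0 → p + C r ∈ T → p ∈ T := by
    intro r hr h
    have := hadd _ h _ (hC (-r) (by linarith))
    simpa using this
  have iter : ∀ n : ℕ, p ∈ T ∨ p + C (r₀ - n / k) ∈ T := by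
    intro n
    induction n with
    | zero => right; simpa using hr
    | succ n ih =>
      rcases ih with h | h
      · exact Or.inl h
      rcases le_total (r₀ - n / k) 0 with h0 | h0
      · exact Or.inl (fin _ h0 h)
      right
      have h1 := hadd _ (hadd _ (hmul _ hks _ h) _ ht) _ (hmul _ (hC _ h0) _ hs)
      have h2 := hmul _ (hC k⁻¹ (by positivity)) _ h1
      convert h2 using 1
      have e0 : (C k⁻¹ : MvPolynomial (Fin d) ℝ) * C k = 1 := by
        rw [← C_mul, inv_mul_cancel₀ hk.ne', C_1]
      have e1 : (C (r₀ - (n + 1 : ℕ) / k) : MvPolynomial (Fin d) ℝ) = C (r₀ - n / k) - C k⁻¹ := by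
        rw [← C_sub]; congr 1; push_cast; field_simp; ring
      rw [e1]
      linear_combination (-(p + C (r₀ - n / k))) * e0 + (C k⁻¹) * hst
  obtain ⟨n, hn⟩ := exists_nat_ge (r₀ * k)
  rcases iter n with h | h
  · exact h
  · refine fin _ ?_ h
    rw [sub_nonpos, le_div_iff₀ hk]
    exact hn
end arch

end part7

section final
variable {d k : ℕ}

lemma sos_add {p q : MvPolynomial (Fin d) ℝ} (hp : IsSOS p) (hq : IsSOS q) : IsSOS (p + q) := by
  obtain ⟨n, u, rfl⟩ := hp
  obtain ⟨m, v, rfl⟩ := hq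
  refine ⟨n + m, Fin.append u v, ?_⟩
  rw [Fin.sum_univ_add]
  simp

lemma sos_zero : IsSOS (0 : MvPolynomial (Fin d) ℝ) := ⟨0, Fin.elim0, by simp⟩

lemma sos_sq (q : MvPolynomial (Fin d) ℝ) : IsSOS (q ^ 2) := ⟨1, fun _ => q, by simp⟩

/-- the preordering as an additive submonoid -/
noncomputable def preSub (f : Fin k → MvPolynomial (Fin d) ℝ) :
    AddSubmonoid (MvPolynomial (Fin d) ℝ) where
  carrier := {p | InPreordering f p}
  zero_mem' := ⟨fun _ => 0, fun _ => sos_zero, by simp⟩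
  add_mem' := by
    rintro a b ⟨σ, h, rfl⟩ ⟨τ, h', rfl⟩
    exact ⟨fun e => σ e + τ e, fun e => sos_add (h e) (h' e), by
      rw [← Finset.sum_add_distrib]; exact Finset.sum_congr rfl fun e _ => by ring⟩

lemma pre_single (f : Fin k → MvPolynomial (Fin d) ℝ) (e : Fin k → Bool)
    (q : MvPolynomial (Fin d) ℝ) : (∏ i, if e i then f i else 1) * q ^ 2 ∈ preSub f := by
  classical
  refine ⟨fun e' => if e' = e then q ^ 2 else 0, fun e' => ?_, ?_⟩
  · dsimp only
    split_ifs
    · exact sos_sq q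
    · exact sos_zero
  · simp

lemma pre_mul (f : Fin k → MvPolynomial (Fin d) ℝ) (a b : MvPolynomial (Fin d) ℝ)
    (ha : a ∈ preSub f) (hb : b ∈ preSub f) : a * b ∈ preSub f := by
  obtain ⟨σ, h, rfl⟩ := ha
  obtain ⟨τ, h', rfl⟩ := hb
  choose n u hu using h
  choose m v hv using h'
  rw [Finset.sum_mul_sum]
  refine sum_mem fun e _ => sum_mem fun e' _ => ?_
  rw [hu, hv, mul_mul_mul_comm, Finset.sum_mul_sum, Finset.mul_sum]
  refine sum_mem fun i _ => ?_
  rw [Finset.mul_sum]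
  refine sum_mem fun j _ => ?_
  have := pre_single f (fun i => xor (e i) (e' i))
    ((∏ i, if (e i && e' i) then f i else 1) * (u e i * v e' j))
  convert this using 1
  rw [mul_pow, mul_pow (u e i), ← mul_assoc _ _ (u e i ^ 2 * v e' j ^ 2), ← Finset.prod_pow,
    ← Finset.prod_mul_distrib, ← Finset.prod_mul_distrib]
  congr 1
  refine Finset.prod_congr rfl fun i _ => ?_
  cases e i <;> cases e' i <;> simp [sq]

lemma pre_sq (f : Fin k → MvPolynomial (Fin d) ℝ) (q : MvPolynomial (Fin d) ℝ) :
    q ^ 2 ∈ preSub f := by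
  simpa using pre_single f (fun _ => false) q

lemma pre_gen (f : Fin k → MvPolynomial (Fin d) ℝ) (i : Fin k) : f i ∈ preSub f := by
  classical
  have := pre_single f (fun j => decide (j = i)) 1
  simpa using this

open CompactlySupported in
/-- Riesz–Haviland theorem for compact sets -/
theorem haviland {K : Set (Fin d → ℝ)} (hK : IsCompact K) (L : MvPolynomial (Fin d) ℝ →ₗ[ℝ] ℝ)
    (hL : ∀ p, (∀ x ∈ K, 0 ≤ MvPolynomial.eval x p) → 0 ≤ L p) :
    ∃ μ : Measure (Fin d → ℝ), IsRadon μ ∧ μ Kᶜ = 0 ∧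
      ∀ p : MvPolynomial (Fin d) ℝ,
        Integrable (fun x => MvPolynomial.eval x p) μ ∧
        L p = ∫ x, MvPolynomial.eval x p ∂μ := by
  have : CompactSpace K := isCompact_iff_compactSpace.mp hK
  have hcont : ∀ p : MvPolynomial (Fin d) ℝ, Continuous fun x => MvPolynomial.eval x p :=
    fun p => MvPolynomial.continuous_eval p
  let res : MvPolynomial (Fin d) ℝ → C_c(K, ℝ) := fun p =>
    { toFun := fun x => MvPolynomial.eval (x : Fin d → ℝ) p
      continuous_toFun := (hcont p).comp continuous_subtype_val
      hasCompactSupport' := HasCompactSupport.of_compactSpace _ }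
  have hres : ∀ p (x : K), res p x = MvPolynomial.eval (x : Fin d → ℝ) p := fun p x => rfl
  let s : PointedCone ℝ (MvPolynomial (Fin d) ℝ × C_c(K, ℝ)) :=
    { carrier := {z | ∀ x : K, 0 ≤ MvPolynomial.eval (x : Fin d → ℝ) z.1 + z.2 x}
      add_mem' := by
        intro a b ha hb x
        have h1 := ha x
        have h2 := hb x
        simp only [Prod.fst_add, Prod.snd_add, map_add, CompactlySupportedContinuousMap.add_apply]
        linarith
      zero_mem' := by intro x; simp
      smul_mem' := by
        rintro ⟨c, hc⟩ a ha x
        have h1 := mul_nonneg hc (ha x)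
        change 0 ≤ MvPolynomial.eval (x : Fin d → ℝ) (c • a.1) + (c • a.2) x
        rw [MvPolynomial.smul_eval, CompactlySupportedContinuousMap.smul_apply, smul_eq_mul]
        linarith }
  have mems : ∀ z : MvPolynomial (Fin d) ℝ × C_c(K, ℝ), z ∈ s ↔ ∀ x : K, 0 ≤ MvPolynomial.eval (x : Fin d → ℝ) z.1 + z.2 x :=
    fun z => Iff.rfl
  let F : (MvPolynomial (Fin d) ℝ × C_c(K, ℝ)) →ₗ.[ℝ] ℝ :=
    { domain := LinearMap.ker (LinearMap.snd ℝ (MvPolynomial (Fin d) ℝ) C_c(K, ℝ))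
      toFun := (L ∘ₗ LinearMap.fst ℝ (MvPolynomial (Fin d) ℝ) C_c(K, ℝ)) ∘ₗ Submodule.subtype _ }
  obtain ⟨g, hg1, hg2⟩ := riesz_extension s F (by
    rintro ⟨⟨p, h⟩, hp⟩ hs
    have hp' : h = 0 := hp
    subst hp'
    change 0 ≤ L p
    refine hL p fun x hx => ?_
    have := (mems _).1 hs ⟨x, hx⟩
    simpa using this) (by
    rintro ⟨p, h⟩
    obtain ⟨c, hc⟩ := (isCompact_univ (X := K)).exists_bound_of_continuousOn
      (h.continuous.continuousOn)
    refine ⟨⟨(-p + MvPolynomial.C c, 0), rfl⟩, ?_⟩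
    rw [mems]
    intro x
    have h1 : |h x| ≤ c := hc x trivial
    have h2 := neg_abs_le (h x)
    simp only [Prod.fst_add, Prod.snd_add, map_add, map_neg, MvPolynomial.eval_C, zero_add]
    linarith)
  have hgL : ∀ p, g (p, 0) = L p := fun p => hg1 ⟨(p, 0), rfl⟩
  let Λ : C_c(K, ℝ) →ₚ[ℝ] ℝ := PositiveLinearMap.mk₀
    (g ∘ₗ LinearMap.inr ℝ (MvPolynomial (Fin d) ℝ) C_c(K, ℝ)) (by
      intro h hh
      apply hg2
      rw [mems]
      intro x
      simpa using hh x)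
  have hΛ : ∀ p, Λ (res p) = L p := by
    intro p
    change g (0, res p) = L p
    have h1 : 0 ≤ g (p, - res p) := hg2 _ (by rw [mems]; intro x; simp [hres])
    have h2 : 0 ≤ g (-p, res p) := hg2 _ (by rw [mems]; intro x; simp [hres])
    have e1 : ((p, - res p) : MvPolynomial (Fin d) ℝ × C_c(K, ℝ)) = (p, 0) - (0, res p) := by ext1 <;> simp
    have e2 : ((-p, res p) : MvPolynomial (Fin d) ℝ × C_c(K, ℝ)) = (0, res p) - (p, 0) := by ext1 <;> simp
    rw [e1, map_sub, hgL] at h1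
    rw [e2, map_sub, hgL] at h2
    linarith
  let ν := RealRMK.rieszMeasure Λ
  have hKm : MeasurableSet K := hK.measurableSet
  have hreg : ν.Regular := by infer_instance
  have hfin : IsFiniteMeasure ν := by infer_instance
  refine ⟨ν.map Subtype.val, ⟨inferInstance, Measure.InnerRegular.map_of_continuous (by fun_prop)⟩,
    ?_, fun p => ⟨?_, ?_⟩⟩
  · rw [Measure.map_apply (by fun_prop) hKm.compl]
    simp
  · rw [integrable_map_measure (hcont p).aestronglyMeasurable (by fun_prop)]
    exact (res p).integrable
  · rw [integral_map (φ := Subtype.val) (by fun_prop) (hcont p).aestronglyMeasurable, ← hΛ,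
      ← RealRMK.integral_rieszMeasure]
    rfl
end final

/-- Solution of the moment problem for compact semi-algebraic sets: every
`T(f)`-positive linear functional is a `K(f)`-moment functional. -/
theorem moment_problem_compact_semialgebraic {d k : ℕ}
    (f : Fin k → MvPolynomial (Fin d) ℝ) (hK : IsCompact (SemiAlgSet f))
    (L : MvPolynomial (Fin d) ℝ →ₗ[ℝ] ℝ)
    (hL : ∀ t : MvPolynomial (Fin d) ℝ, InPreordering f t → 0 ≤ L t) :
    ∃ μ : Measure (Fin d → ℝ), IsRadon μ ∧ μ (SemiAlgSet f)ᶜ = 0 ∧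
      ∀ p : MvPolynomial (Fin d) ℝ,
        Integrable (fun x => MvPolynomial.eval x p) μ ∧
        L p = ∫ x, MvPolynomial.eval x p ∂μ := by
  have hN : ∃ N : ℝ, 0 ≤ N ∧ ∀ a : Fin d → ℝ, (∀ i, 0 ≤ MvPolynomial.eval a (f i)) →
      ∑ i, a i ^ 2 < N := by
    obtain ⟨c, hc⟩ := hK.exists_bound_of_continuousOn (f := fun a : Fin d → ℝ => ∑ i, a i ^ 2)
      (by fun_prop)
    refine ⟨|c| + 1, by positivity, fun a ha => ?_⟩
    have h1 := hc a ha
    rw [Real.norm_eq_abs] at h1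
    linarith [le_abs_self (∑ i, a i ^ 2), le_abs_self c]
  have hpos : ∀ p : MvPolynomial (Fin d) ℝ,
      (∀ a : Fin d → ℝ, (∀ i, 0 ≤ MvPolynomial.eval a (f i)) → 0 < MvPolynomial.eval a p) →
      0 ≤ L p := fun p hp => hL p
    (T_pos f (preSub f : Set (MvPolynomial (Fin d) ℝ)) (fun x hx y hy => add_mem hx hy)
      (fun x hx y hy => pre_mul f x y hx hy) (pre_sq f) (pre_gen f) hN p hp)
  refine haviland hK L fun p hp => ?_
  by_contra hneg
  push Not at hneg
  have hε : ∀ ε : ℝ, 0 < ε → 0 ≤ L p + ε * L 1 := by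
    intro ε hε
    have := hpos (p + ε • 1) (fun a ha => by
      have := hp a ha
      simp only [map_add, MvPolynomial.smul_eval, map_one]
      linarith)
    simpa using this
  have h1 := hε 1 one_pos
  have hL1 : 0 < L 1 := by linarith
  have h2 := hε (- L p / (2 * L 1)) (by apply div_pos <;> linarith)
  have : - L p / (2 * L 1) * L 1 = - L p / 2 := by field_simp
  rw [this] at h2
  linarith
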